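/- arXiv:1401.3583 — 4 statements merged into one kernel-verified Lean document; each statement's English description precedes it below -/
import Mathlib

section
/- Let N > 0, β > 0, p > β, 0 ≤ a < b, and H ∈ (0,1) be fixed, and set α = β − 1/H. Then there exist constants C > 0 and N₀ > 0 (depending on a, b, β, N, H, p) such that, with the Newtonian kernel K_α defined using the constant N₀, for all r ∈ (0, N] one has ∫_a^b ∫_a^b |t − s|^{−Hβ} · ( (|t − s|^H / r) ∧ 1 )^p ds dt ≤ C · K_α(r). -/
open MeasureTheory Set

/-- The `α`-dimensional Newtonian kernel (real valued), with constant `N₀` in the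
logarithmic case. -/
noncomputable def newtonianKernelReal (α N₀ r : ℝ) : ℝ :=
  if 0 < α then r ^ (-α)
  else if α = 0 then Real.log (N₀ / r)
  else 1

noncomputable def ffun (β p H r u : ℝ) : ℝ := |u| ^ (-(H * β)) * (min (|u| ^ H / r) 1) ^ p

lemma ffun_nonneg (β p H r u : ℝ) (hr : 0 < r) : 0 ≤ ffun β p H r u := by
  unfold ffun
  have : 0 ≤ min (|u| ^ H / r) 1 := le_min (by positivity) zero_le_one
  positivity

lemma ffun_meas (β p H r : ℝ) : Measurable (ffun β p H r) := by
  unfold ffun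
  fun_prop

lemma ffun_le1 (β p H r u : ℝ) (hr : 0 < r) (hp : 0 < p) :
    ffun β p H r u ≤ |u| ^ (-(H * β)) := by
  unfold ffun
  have h0 : 0 ≤ min (|u| ^ H / r) 1 := le_min (by positivity) zero_le_one
  exact mul_le_of_le_one_right (by positivity)
    (Real.rpow_le_one h0 (min_le_right _ _) hp.le)

lemma ffun_le2 (β p H r u : ℝ) (hr : 0 < r) (hβ : 0 < β) (hp : β < p) (hH : 0 < H) :
    ffun β p H r u ≤ r ^ (-β) := by
  have h0 : 0 ≤ min (|u| ^ H / r) 1 := le_min (by positivity) zero_le_one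
  rcases eq_or_ne u 0 with rfl | hu
  · unfold ffun
    rw [abs_zero, Real.zero_rpow (by simp; constructor <;> positivity)]
    simp; positivity
  have hu' : 0 < |u| := abs_pos.mpr hu
  have hm : 0 < min (|u| ^ H / r) 1 := lt_min (by positivity) one_pos
  have h1 : (min (|u| ^ H / r) 1) ^ p ≤ (min (|u| ^ H / r) 1) ^ β :=
    Real.rpow_le_rpow_of_exponent_ge hm (min_le_right _ _) hp.le
  have h2 : (min (|u| ^ H / r) 1) ^ β ≤ (|u| ^ H / r) ^ β :=
    Real.rpow_le_rpow h0 (min_le_left _ _) hβ.le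
  unfold ffun
  calc _ ≤ |u| ^ (-(H * β)) * (|u| ^ H / r) ^ β := by gcongr; exact h1.trans h2
    _ = r ^ (-β) := by
      rw [Real.div_rpow (by positivity) hr.le, ← Real.rpow_mul hu'.le, Real.rpow_neg hu'.le,
        Real.rpow_neg hr.le]
      have : |u| ^ (H * β) ≠ 0 := by positivity
      field_simp

lemma ffun_int (β p H r x y : ℝ) (hr : 0 < r) (hβ : 0 < β) (hp : β < p) (hH : 0 < H) :
    IntervalIntegrable (ffun β p H r) MeasureTheory.volume x y := by
  refine (intervalIntegrable_const (c := r ^ (-β))).mono_fun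
    (ffun_meas β p H r).aestronglyMeasurable (Filter.Eventually.of_forall fun u => ?_)
  show ‖ffun β p H r u‖ ≤ ‖r ^ (-β)‖
  rw [Real.norm_of_nonneg (ffun_nonneg β p H r u hr), Real.norm_of_nonneg (by positivity)]
  exact ffun_le2 β p H r u hr hβ hp hH

lemma half_bound (β p H r ρ M : ℝ) (hr : 0 < r) (hβ : 0 < β) (hp : β < p) (hH : 0 < H)
    (hρ : 0 < ρ) (hρM : ρ ≤ M) :
    ∫ u in (0:ℝ)..M, ffun β p H r u ≤ ρ * r ^ (-β) + ∫ u in ρ..M, u ^ (-(H * β)) := by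
  have hi := fun x y => ffun_int β p H r x y hr hβ hp hH
  rw [← intervalIntegral.integral_add_adjacent_intervals (hi 0 ρ) (hi ρ M)]
  refine add_le_add ?_ ?_
  · calc _ ≤ ∫ u in (0:ℝ)..ρ, r ^ (-β) :=
        intervalIntegral.integral_mono_on hρ.le (hi _ _) intervalIntegrable_const
          fun u _ => ffun_le2 β p H r u hr hβ hp hH
      _ = _ := by simp
  · refine intervalIntegral.integral_mono_on hρM (hi _ _) ?_ ?_
    · refine intervalIntegral.intervalIntegrable_rpow (Or.inr ?_)
      rw [Set.uIcc_of_le hρM]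
      exact fun h => absurd h.1 (not_le.mpr hρ)
    · intro u hu
      have := ffun_le1 β p H r u hr (hβ.trans hp)
      rwa [abs_of_pos (hρ.trans_le hu.1)] at this

lemma full_bound (β p H r a b t M : ℝ) (hr : 0 < r) (hβ : 0 < β) (hp : β < p) (hH : 0 < H)
    (hM : b - a ≤ M) (ht : t ∈ Set.Icc a b) :
    ∫ s in a..b, ffun β p H r (t - s) ≤ 2 * ∫ u in (0:ℝ)..M, ffun β p H r u := by
  have hi := fun x y => ffun_int β p H r x y hr hβ hp hH
  obtain ⟨h1, h2⟩ := ht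
  rw [intervalIntegral.integral_comp_sub_left (fun u => ffun β p H r u)]
  have hsym : ∫ u in (-M)..0, ffun β p H r u = ∫ u in (0:ℝ)..M, ffun β p H r u := by
    have := intervalIntegral.integral_comp_neg (a := 0) (b := M) (fun u => ffun β p H r u)
    rw [neg_zero] at this
    rw [← this]
    simp [ffun]
  calc _ ≤ ∫ u in (-M)..M, ffun β p H r u :=
        intervalIntegral.integral_mono_interval (by linarith) (by linarith) (by linarith)
          (Filter.Eventually.of_forall fun u => ffun_nonneg β p H r u hr) (hi _ _)
    _ = _ := by
      rw [← intervalIntegral.integral_add_adjacent_intervals (hi (-M) 0) (hi 0 M), hsym]; ring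

lemma kernel_bound (N β H M : ℝ) (hN : 0 < N) (hβ : 0 < β) (hH0 : 0 < H) (hH1 : H < 1)
    (hM : N ^ (1 / H) ≤ M) :
    ∃ C N₀ : ℝ, 0 < C ∧ 0 < N₀ ∧ ∀ r ∈ Set.Ioc (0 : ℝ) N,
      r ^ (1 / H) * r ^ (-β) + ∫ u in (r ^ (1 / H))..M, u ^ (-(H * β))
        ≤ C * newtonianKernelReal (β - 1 / H) N₀ r := by
  have hM0 : 0 < M := lt_of_lt_of_le (by positivity) hM
  have hrM : ∀ r ∈ Set.Ioc (0 : ℝ) N, r ^ (1 / H) ≤ M := fun r hr =>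
    (Real.rpow_le_rpow hr.1.le hr.2 (by positivity)).trans hM
  have h0 : ∀ r ∈ Set.Ioc (0 : ℝ) N, (0:ℝ) ∉ Set.uIcc (r ^ (1 / H)) M := by
    intro r hr
    rw [Set.uIcc_of_le (hrM r hr)]
    exact fun h => absurd h.1 (not_le.mpr (Real.rpow_pos_of_pos hr.1 _))
  have hfirst : ∀ r ∈ Set.Ioc (0 : ℝ) N, r ^ (1 / H) * r ^ (-β) = r ^ (1 / H - β) := by
    intro r hr
    rw [← Real.rpow_add hr.1]; ring_nf
  have hpow : ∀ r ∈ Set.Ioc (0 : ℝ) N, (r ^ (1 / H)) ^ (1 - H * β) = r ^ (1 / H - β) := by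
    intro r hr
    rw [← Real.rpow_mul hr.1.le]
    congr 1
    field_simp
  have hint : H * β ≠ 1 → ∀ r ∈ Set.Ioc (0 : ℝ) N,
      ∫ u in (r ^ (1 / H))..M, u ^ (-(H * β)) =
        (M ^ (1 - H * β) - r ^ (1 / H - β)) / (1 - H * β) := by
    intro hne r hr
    rw [integral_rpow (Or.inr ⟨fun h => hne (by linarith), h0 r hr⟩),
      show -(H * β) + 1 = 1 - H * β by ring, hpow r hr]
  rcases lt_trichotomy (H * β) 1 with h | h | h
  · have hα : β - 1 / H < 0 := by
      rw [sub_neg, lt_div_iff₀ hH0]; linarith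
    refine ⟨M ^ (1 - H * β) + M ^ (1 - H * β) / (1 - H * β), 1, ?_, one_pos, ?_⟩
    · have : 0 < 1 - H * β := by linarith
      positivity
    intro r hr
    have h1 : 0 < 1 - H * β := by linarith
    rw [hint h.ne r hr, hfirst r hr, newtonianKernelReal, if_neg hα.le.not_gt, if_neg hα.ne,
      mul_one]
    have hr0 := hr.1
    have : r ^ (1 / H - β) ≤ M ^ (1 - H * β) := by
      rw [← hpow r hr]
      exact Real.rpow_le_rpow (by positivity) (hrM r hr) h1.le
    have h3 : 0 ≤ r ^ (1 / H - β) := by positivity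
    gcongr
    linarith
  · have hα : β - 1 / H = 0 := by
      rw [sub_eq_zero, eq_div_iff hH0.ne']; linarith
    have hα' : 1 / H - β = 0 := by linarith
    refine ⟨1 / H, Real.exp 1 * M ^ H, by positivity, by positivity, ?_⟩
    intro r hr
    have hr0 := hr.1
    rw [hfirst r hr, newtonianKernelReal, if_neg (by rw [hα]; exact lt_irrefl _), if_pos hα, h,
      hα', Real.rpow_zero]
    simp_rw [Real.rpow_neg_one]
    rw [integral_inv (h0 r hr), Real.log_div hM0.ne' (by positivity),
      Real.log_div (by positivity) hr0.ne', Real.log_mul (by positivity) (by positivity),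
      Real.log_exp, Real.log_rpow hr0, Real.log_rpow hM0]
    have : 1 ≤ 1 / H := by rw [le_div_iff₀ hH0]; linarith
    have e : 1 / H * (1 + H * Real.log M - Real.log r) =
      1 / H + (Real.log M - 1 / H * Real.log r) := by field_simp; ring
    rw [e]
    linarith
  · have hα : 0 < β - 1 / H := by
      rw [sub_pos, div_lt_iff₀ hH0]; linarith
    have h1 : 0 < H * β - 1 := by linarith
    refine ⟨1 + 1 / (H * β - 1), 1, by positivity, one_pos, ?_⟩
    intro r hr
    rw [hint h.ne' r hr, hfirst r hr, newtonianKernelReal, if_pos hα, neg_sub]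
    have h2 : (M ^ (1 - H * β) - r ^ (1 / H - β)) / (1 - H * β) =
      (r ^ (1 / H - β) - M ^ (1 - H * β)) / (H * β - 1) := by
      rw [← neg_div_neg_eq]; ring_nf
    have h3 : (r ^ (1 / H - β) - M ^ (1 - H * β)) / (H * β - 1) ≤
        r ^ (1 / H - β) / (H * β - 1) := by
      gcongr
      have : 0 ≤ M ^ (1 - H * β) := by positivity
      linarith
    rw [h2, add_mul, one_mul, div_mul_eq_mul_div, one_mul]
    linarith

/-- For `α = β - 1/H` there are constants `C, N₀ > 0` such that for all
`r ∈ (0, N]`,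
`∫_a^b ∫_a^b |t-s|^{-Hβ} ((|t-s|^H / r) ∧ 1)^p ds dt ≤ C · K_α(r)`. -/
theorem stmt2 (N β p a b H : ℝ)
    (hN : 0 < N) (hβ : 0 < β) (hp : β < p)
    (ha : 0 ≤ a) (hab : a < b) (hH0 : 0 < H) (hH1 : H < 1) :
    ∃ C N₀ : ℝ, 0 < C ∧ 0 < N₀ ∧ ∀ r ∈ Set.Ioc (0 : ℝ) N,
      (∫ t in a..b, ∫ s in a..b,
          |t - s| ^ (-(H * β)) * (min (|t - s| ^ H / r) 1) ^ p)
        ≤ C * newtonianKernelReal (β - 1 / H) N₀ r := by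
  set M : ℝ := max (N ^ (1 / H)) (b - a) with hMdef
  obtain ⟨C, N₀, hC, hN₀, hk⟩ := kernel_bound N β H M hN hβ hH0 hH1 (le_max_left _ _)
  have hL : 0 < b - a := sub_pos.mpr hab
  refine ⟨(b - a) * (2 * C), N₀, by positivity, hN₀, ?_⟩
  intro r hr
  have hr0 := hr.1
  have key : ∀ t ∈ Set.uIoc a b, ‖∫ s in a..b, ffun β p H r (t - s)‖ ≤
      2 * (C * newtonianKernelReal (β - 1 / H) N₀ r) := by
    intro t ht
    rw [Set.uIoc_of_le hab.le] at ht
    rw [Real.norm_of_nonneg (intervalIntegral.integral_nonneg hab.le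
      fun s _ => ffun_nonneg β p H r (t - s) hr0)]
    refine (full_bound β p H r a b t M hr0 hβ hp hH0 (le_max_right _ _) ⟨ht.1.le, ht.2⟩).trans ?_
    have hρ : r ^ (1 / H) ≤ M :=
      (Real.rpow_le_rpow hr0.le hr.2 (by positivity)).trans (le_max_left _ _)
    have := (half_bound β p H r (r ^ (1 / H)) M hr0 hβ hp hH0 (by positivity) hρ).trans (hk r hr)
    linarith
  have := intervalIntegral.norm_integral_le_of_norm_le_const key
  rw [abs_of_pos hL] at this
  refine (le_trans (Real.le_norm_self _) this).trans (le_of_eq ?_)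
  ring
end

section
/- Let H ∈ (1/2, 1), ε ∈ (0, 1) and γ > H − 1/2, and define the kernel derivative ∂_v K(v,u) = u^{1/2 − H} (v − u)^{H − 3/2} v^{H − 1/2} for 0 < u < v ≤ 1 (i.e. K is the fractional Brownian Volterra kernel K(t,s) = s^{1/2−H} ∫ₛᵗ (u − s)^{H − 3/2} u^{H − 1/2} du, normalized with constant 1). There exists a constant C₁ > 0 (depending on H, γ, ε, n) such that for every γ-Hölder continuous f : [0,1] → ℝⁿ and all ε ≤ s < t ≤ 1: C₁ · (t − s)^{2H} · (min_{[0,1]} |f|)⁴ / ( ‖f‖_∞² + ‖f‖_γ² ) ≤ ∫ₛᵗ | ∫ᵤᵗ ∂_v K(v,u) f(v) dv |² du. -/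
open MeasureTheory Set

/-- Supremum norm of `f` over `[0,1]`: `‖f‖_∞ = sup_{u ∈ [0,1]} ‖f u‖`. -/
noncomputable def supNorm01 {E : Type*} [NormedAddCommGroup E] (f : ℝ → E) : ℝ :=
  sSup ((fun u => ‖f u‖) '' Set.Icc (0 : ℝ) 1)

/-- Minimum of `‖f‖` over `[0,1]`: `min_{u ∈ [0,1]} ‖f u‖`. -/
noncomputable def minNorm01 {E : Type*} [NormedAddCommGroup E] (f : ℝ → E) : ℝ :=
  sInf ((fun u => ‖f u‖) '' Set.Icc (0 : ℝ) 1)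

/-- Hölder seminorm of exponent `γ` of `f` on `[0,1]`:
`‖f‖_γ = sup_{0 ≤ u < v ≤ 1} ‖f v - f u‖ / (v - u)^γ`. -/
noncomputable def holderNorm01 {E : Type*} [NormedAddCommGroup E] (γ : ℝ) (f : ℝ → E) : ℝ :=
  sSup {c : ℝ | ∃ u v : ℝ, 0 ≤ u ∧ u < v ∧ v ≤ 1 ∧ c = ‖f v - f u‖ / (v - u) ^ γ}

/-- The `t`-derivative of the fBm Volterra kernel (normalized with constant `1`) for
`H > 1/2`: `∂_v K(v,u) = u^{1/2-H} (v-u)^{H-3/2} v^{H-1/2}`. -/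
noncomputable def volterraKernelDeriv (H v u : ℝ) : ℝ :=
  u ^ (1 / 2 - H) * (v - u) ^ (H - 3 / 2) * v ^ (H - 1 / 2)


/-- truncated power -/
noncomputable def tpow (b x : ℝ) : ℝ := if 0 < x then x ^ b else 0

lemma tpow_nonneg (b x : ℝ) : 0 ≤ tpow b x := by
  unfold tpow; split_ifs with h
  · exact Real.rpow_nonneg h.le _
  · exact le_rfl

lemma tpow_of_pos {b x : ℝ} (h : 0 < x) : tpow b x = x ^ b := if_pos h
lemma tpow_of_nonpos {b x : ℝ} (h : x ≤ 0) : tpow b x = 0 := if_neg (not_lt.2 h)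

lemma measurable_tpow (b : ℝ) : Measurable (tpow b) := by
  unfold tpow
  exact Measurable.ite measurableSet_Ioi (by fun_prop) measurable_const

lemma ipow_integral {b d : ℝ} (hb : -1 < b) (hd : 0 ≤ d) :
    Integrable ((Ioc 0 d).indicator fun x : ℝ => x ^ b) ∧
      ∫ x, (Ioc 0 d).indicator (fun x : ℝ => x ^ b) x = d ^ (b + 1) / (b + 1) := by
  constructor
  · rw [integrable_indicator_iff measurableSet_Ioc]
    exact (intervalIntegrable_iff_integrableOn_Ioc_of_le hd).1
      (intervalIntegral.intervalIntegrable_rpow' hb)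
  · rw [integral_indicator measurableSet_Ioc, ← intervalIntegral.integral_of_le hd,
      integral_rpow (Or.inl hb), Real.zero_rpow (by linarith), sub_zero]

lemma beta_base {α : ℝ} (h0 : 0 < α) (h1 : α < 1) :
    Integrable fun x => tpow (-α) x * tpow (α - 1) (1 - x) := by
  have i1 := (ipow_integral (b := -α) (d := 1) (by linarith) zero_le_one).1
  have i2 := ((ipow_integral (b := α - 1) (d := 1) (by linarith) zero_le_one).1).comp_sub_left 1
  refine ((i1.const_mul 2).add (i2.const_mul 2)).mono' ?_ (Filter.Eventually.of_forall fun x => ?_)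
  · exact ((measurable_tpow _).mul ((measurable_tpow _).comp
      (measurable_const.sub measurable_id))).aestronglyMeasurable
  · have n1 := tpow_nonneg (-α) x
    have n2 := tpow_nonneg (α-1) (1-x)
    rw [Real.norm_of_nonneg (mul_nonneg n1 n2)]
    simp only [Pi.add_apply]
    rcases le_or_gt x 0 with hx | hx
    · rw [tpow_of_nonpos hx, zero_mul]
      apply add_nonneg <;> refine mul_nonneg zero_le_two (indicator_nonneg (fun y hy => Real.rpow_nonneg hy.1.le _) _)
    rcases le_or_gt 1 x with hx1 | hx1
    · rw [tpow_of_nonpos (x := 1 - x) (by linarith), mul_zero]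
      apply add_nonneg <;> refine mul_nonneg zero_le_two (indicator_nonneg (fun y hy => Real.rpow_nonneg hy.1.le _) _)
    rw [indicator_of_mem (show x ∈ Ioc (0:ℝ) 1 from ⟨hx, hx1.le⟩),
      indicator_of_mem (show 1 - x ∈ Ioc (0:ℝ) 1 from ⟨by linarith, by linarith⟩)]
    rw [tpow_of_pos hx] at *
    rw [tpow_of_pos (show 0 < 1 - x by linarith)] at *
    have key : ∀ y : ℝ, 1/2 ≤ y → ∀ e : ℝ, -1 ≤ e → e ≤ 0 → y ^ e ≤ 2 := by
      intro y hy e he he0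
      calc y ^ e ≤ (1/2:ℝ) ^ e := Real.rpow_le_rpow_of_nonpos (by norm_num) hy he0
        _ ≤ (1/2:ℝ) ^ (-1:ℝ) := Real.rpow_le_rpow_of_exponent_ge (by norm_num) (by norm_num) he
        _ = 2 := by rw [Real.rpow_neg_one]; norm_num
    rcases le_total x (1/2) with h | h
    · have := key (1-x) (by linarith) (α-1) (by linarith) (by linarith)
      nlinarith
    · have := key x h (-α) (by linarith) (by linarith)
      nlinarith

/-- the beta constant -/
noncomputable def betaC (α : ℝ) : ℝ := ∫ x, tpow (-α) x * tpow (α - 1) (1 - x)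

lemma betaC_ge {α : ℝ} (h0 : 0 < α) (h1 : α < 1) : 1 ≤ betaC α := by
  have : ∫ x, (Ioo (0:ℝ) 1).indicator (fun _ => (1:ℝ)) x = 1 := by
    rw [integral_indicator measurableSet_Ioo]; simp
  rw [← this]
  refine integral_mono ?_ (beta_base h0 h1) ?_
  · rw [integrable_indicator_iff measurableSet_Ioo]
    exact integrableOn_const (by simp)
  · intro x
    by_cases hx : x ∈ Ioo (0:ℝ) 1
    · simp only [indicator_of_mem hx]
      rw [tpow_of_pos hx.1, tpow_of_pos (by linarith [hx.2])]
      exact one_le_mul_of_one_le_of_one_le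
        (Real.one_le_rpow_of_pos_of_le_one_of_nonpos hx.1 hx.2.le (by linarith))
        (Real.one_le_rpow_of_pos_of_le_one_of_nonpos (by linarith [hx.2]) (by linarith [hx.1]) (by linarith))
    · simp only [indicator_of_notMem hx]
      exact mul_nonneg (tpow_nonneg _ _) (tpow_nonneg _ _)

lemma tpow_mul {b r x : ℝ} (hr : 0 < r) : tpow b (r * x) = r ^ b * tpow b x := by
  unfold tpow
  by_cases hx : 0 < x
  · rw [if_pos hx, if_pos (mul_pos hr hx), Real.mul_rpow hr.le hx.le]
  · rw [if_neg hx, if_neg, mul_zero]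
    intro h; exact hx (pos_of_mul_pos_right h hr.le)

lemma beta_gen {α : ℝ} (h0 : 0 < α) (h1 : α < 1) (a v : ℝ) :
    (Integrable fun u => tpow (-α) (u - a) * tpow (α - 1) (v - u)) ∧
    ∫ u, tpow (-α) (u - a) * tpow (α - 1) (v - u) = if a < v then betaC α else 0 := by
  have e0 : (fun u => tpow (-α) (u - a) * tpow (α - 1) (v - u)) =
      fun u => (fun x => tpow (-α) x * tpow (α - 1) ((v - a) - x)) (u - a) := by
    funext u; simp only; congr 2; ring
  set r := v - a with hr
  suffices H : (Integrable fun x => tpow (-α) x * tpow (α - 1) (r - x)) ∧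
      ∫ x, tpow (-α) x * tpow (α - 1) (r - x) = if a < v then betaC α else 0 by
    rw [e0]
    refine ⟨H.1.comp_sub_right a, ?_⟩
    rw [integral_sub_right_eq_self (fun x => tpow (-α) x * tpow (α - 1) (r - x)) a]
    exact H.2
  split_ifs with hav
  · have hr0 : 0 < r := by linarith
    have e1 : (fun x => tpow (-α) x * tpow (α - 1) (r - x)) =
        fun x => r⁻¹ * (fun y => tpow (-α) y * tpow (α - 1) (1 - y)) (r⁻¹ * x) := by
      funext x
      have ex : x = r * (r⁻¹ * x) := by field_simp
      have ex2 : r - x = r * (1 - r⁻¹ * x) := by field_simp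
      simp only
      rw [ex2]
      nth_rw 1 [ex]
      rw [tpow_mul hr0, tpow_mul hr0, mul_mul_mul_comm, ← Real.rpow_add hr0,
        show -α + (α - 1) = -1 by ring, Real.rpow_neg_one]
    rw [e1]
    refine ⟨((beta_base h0 h1).comp_mul_left' (inv_ne_zero hr0.ne')).const_mul _, ?_⟩
    rw [integral_const_mul, Measure.integral_comp_mul_left (fun y => tpow (-α) y * tpow (α - 1) (1 - y))]
    rw [inv_inv, abs_of_pos hr0, smul_eq_mul, ← mul_assoc, inv_mul_cancel₀ hr0.ne', one_mul]; rfl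
  · have : (fun x => tpow (-α) x * tpow (α - 1) (r - x)) = fun _ => 0 := by
      funext x
      rcases le_or_gt x 0 with hx | hx
      · rw [tpow_of_nonpos hx, zero_mul]
      · rw [tpow_of_nonpos (x := r - x) (by linarith), mul_zero]
    rw [this]; simp

lemma fubini_beta {α : ℝ} (h0 : 0 < α) (h1 : α < 1) (a : ℝ) (q : ℝ → ℝ) (hq : Integrable q) :
    (Integrable fun u => tpow (-α) (u - a) * ∫ v, tpow (α - 1) (v - u) * q v) ∧
    ∫ u, tpow (-α) (u - a) * ∫ v, tpow (α - 1) (v - u) * q v =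
      betaC α * ∫ v, if a < v then q v else 0 := by
  set F : ℝ × ℝ → ℝ := fun z => (tpow (-α) (z.1 - a) * tpow (α - 1) (z.2 - z.1)) * q z.2 with hF
  have Fm : AEStronglyMeasurable F (volume.prod volume) := by
    refine AEStronglyMeasurable.mul ?_ hq.1.comp_snd
    exact (((measurable_tpow _).comp (measurable_fst.sub measurable_const)).mul
      ((measurable_tpow _).comp (measurable_snd.sub measurable_fst))).aestronglyMeasurable
  have nn : ∀ u v, 0 ≤ tpow (-α) (u - a) * tpow (α - 1) (v - u) := fun u v =>
    mul_nonneg (tpow_nonneg _ _) (tpow_nonneg _ _)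
  have Fi : Integrable F (volume.prod volume) := by
    rw [integrable_prod_iff' Fm]
    refine ⟨Filter.Eventually.of_forall fun v => by
      simpa only [hF] using (beta_gen h0 h1 a v).1.mul_const (q v), ?_⟩
    have : (fun v => ∫ u, ‖F (u, v)‖) = fun v => betaC α * (Ioi a).indicator (fun v => ‖q v‖) v := by
      funext v
      simp only [hF, norm_mul (_ * _) (q v), Real.norm_of_nonneg (nn _ _)]
      rw [integral_mul_const, (beta_gen h0 h1 a v).2]
      by_cases h : a < v
      · rw [if_pos h, indicator_of_mem (show v ∈ Ioi a from h)]
      · rw [if_neg h, indicator_of_notMem (show v ∉ Ioi a from h)]; simp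
    rw [this]
    exact (hq.norm.indicator measurableSet_Ioi).const_mul _
  have e : ∀ u, tpow (-α) (u - a) * ∫ v, tpow (α - 1) (v - u) * q v = ∫ v, F (u, v) := by
    intro u
    rw [← integral_const_mul]
    congr 1; funext v; simp only [hF]; ring
  simp only [e]
  refine ⟨Fi.integral_prod_left, ?_⟩
  rw [integral_integral_swap Fi, ← integral_const_mul]
  congr 1; funext v
  simp only [hF]
  rw [integral_mul_const, (beta_gen h0 h1 a v).2]
  split_ifs <;> simp

/-- constant in the power comparison -/
lemma pow_compare {α γ : ℝ} (h0 : 0 < α) (hγ : α < γ) :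
    ∃ C : ℝ, 0 ≤ C ∧ ∀ A B : ℝ, 0 < B → B ≤ A → A ≤ 2 * B →
      A ^ γ * (B ^ (-α) - A ^ (-α)) ≤ C * (A ^ (γ - α) - B ^ (γ - α)) := by
  set p := γ - α with hp
  have hp0 : 0 < p := by linarith
  refine ⟨2 ^ p * (α * 2 ^ α / p), by positivity, fun A B hB hBA hAB => ?_⟩
  obtain ⟨r, rfl⟩ : ∃ r, A = r * B := ⟨A / B, by field_simp⟩
  have hr1 : 1 ≤ r := by nlinarith
  have hr2 : r ≤ 2 := by nlinarith
  have hr0 : 0 < r := by linarith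
  have l0 : 0 ≤ Real.log r := Real.log_nonneg hr1
  have k1 : p * Real.log r ≤ r ^ p - 1 := by
    rw [Real.rpow_def_of_pos hr0]
    have := Real.add_one_le_exp (Real.log r * p); linarith
  have k2 : r ^ α - 1 ≤ α * Real.log r * 2 ^ α := by
    have hra : r ^ α * (1 - r ^ (-α)) = r ^ α - 1 := by
      rw [mul_sub, ← Real.rpow_add hr0]; simp
    have : 1 - r ^ (-α) ≤ α * Real.log r := by
      rw [Real.rpow_def_of_pos hr0]
      have := Real.add_one_le_exp (Real.log r * -α); linarith
    rw [← hra, mul_comm]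
    have h2 : r ^ α ≤ 2 ^ α := Real.rpow_le_rpow hr0.le hr2 h0.le
    have h3 : 0 ≤ r ^ α := Real.rpow_nonneg hr0.le _
    calc _ ≤ (α * Real.log r) * r ^ α := mul_le_mul_of_nonneg_right this h3
      _ ≤ _ := mul_le_mul_of_nonneg_left h2 (by positivity)
  have k3 : r ^ α - 1 ≤ α * 2 ^ α / p * (r ^ p - 1) := by
    have : α * Real.log r * 2 ^ α = α * 2 ^ α / p * (p * Real.log r) := by field_simp
    rw [this] at k2
    exact k2.trans (mul_le_mul_of_nonneg_left k1 (by positivity))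
  have k4 : r ^ p ≤ 2 ^ p := Real.rpow_le_rpow hr0.le hr2 hp0.le
  have k5 : 1 ≤ r ^ α := Real.one_le_rpow hr1 h0.le
  have eg : γ = p + α := by rw [hp]; ring
  have e1 : (r * B) ^ γ * (B ^ (-α) - (r * B) ^ (-α)) = B ^ p * (r ^ p * (r ^ α - 1)) := by
    rw [eg, Real.mul_rpow hr0.le hB.le, Real.mul_rpow hr0.le hB.le, Real.rpow_add hr0, Real.rpow_add hB,
      Real.rpow_neg hr0.le, Real.rpow_neg hB.le]
    have : 0 < r ^ α := by positivity
    have : 0 < B ^ α := by positivity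
    field_simp
  rw [e1, Real.mul_rpow hr0.le hB.le]
  have : r ^ p * (r ^ α - 1) ≤ 2 ^ p * (α * 2 ^ α / p * (r ^ p - 1)) :=
    mul_le_mul k4 k3 (by linarith) (by positivity)
  calc _ ≤ B ^ p * (2 ^ p * (α * 2 ^ α / p * (r ^ p - 1))) :=
        mul_le_mul_of_nonneg_left this (by positivity)
    _ = _ := by ring

lemma abel {E : Type*} [AddCommGroup E] [Module ℝ E] (w : ℕ → ℝ) (b : ℕ → E) (k : ℕ) :
    ∑ i ∈ Finset.range (k+1), w i • (b i - if i = 0 then 0 else b (i-1)) =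
      w 0 • b k + ∑ i ∈ Finset.range k, (w (i+1) - w i) • (b k - b i) := by
  induction k with
  | zero => simp
  | succ k ih =>
    rw [Finset.sum_range_succ, ih, Finset.sum_range_succ]
    have : ∑ i ∈ Finset.range k, (w (i+1) - w i) • (b (k+1) - b i) =
        ∑ i ∈ Finset.range k, (w (i+1) - w i) • (b k - b i) + (w k - w 0) • (b (k+1) - b k) := by
      rw [← Finset.sum_range_sub, Finset.sum_smul, ← Finset.sum_add_distrib]
      refine Finset.sum_congr rfl fun i _ => ?_
      rw [← smul_add]; congr 1; abel
    rw [this]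
    simp only [Nat.add_eq_zero_iff, one_ne_zero, and_false, if_false, Nat.add_sub_cancel]
    module

lemma pw_bound {E : Type*} [NormedAddCommGroup E] [NormedSpace ℝ E] {α γ C : ℝ} (h0 : 0 < α)
    (hγ : α < γ) (hC0 : 0 ≤ C)
    (hC : ∀ A B : ℝ, 0 < B → B ≤ A → A ≤ 2 * B →
      A ^ γ * (B ^ (-α) - A ^ (-α)) ≤ C * (A ^ (γ - α) - B ^ (γ - α)))
    {s δ u S L : ℝ} (hδ : 0 < δ) (b : ℕ → E) (k : ℕ) (hL : 0 ≤ L)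
    (hku : s + k * δ < u) (hu : u ≤ s + 1) (hbS : ‖b k‖ ≤ S)
    (hb : ∀ i < k, ‖b k - b i‖ ≤ L * (((k:ℝ) - i) * δ) ^ γ) :
    ‖∑ i ∈ Finset.range (k+1), tpow (-α) (u - (s + i * δ)) • (b i - if i = 0 then 0 else b (i-1))‖
      ≤ S * (u - s) ^ (-α) + L * C + L * δ ^ γ * (u - (s + k * δ)) ^ (-α) := by
  rw [abel (fun i => tpow (-α) (u - (s + i * δ))) b k]
  have hpos : ∀ i : ℕ, i ≤ k → 0 < u - (s + i * δ) := by
    intro i hi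
    have : (i:ℝ) ≤ k := by exact_mod_cast hi
    nlinarith
  have hw : ∀ i : ℕ, i ≤ k → tpow (-α) (u - (s + i * δ)) = (u - (s + i * δ)) ^ (-α) :=
    fun i hi => tpow_of_pos (hpos i hi)
  have hmono : ∀ i : ℕ, i < k →
      0 ≤ (u - (s + (i+1:ℕ) * δ)) ^ (-α) - (u - (s + i * δ)) ^ (-α) := by
    intro i hi
    rw [sub_nonneg]
    refine Real.rpow_le_rpow_of_nonpos (hpos (i+1) hi) ?_ (by linarith)
    push_cast; nlinarith
  have hsum : ∑ i ∈ Finset.range k, ((u - (s + (i+1:ℕ) * δ)) ^ (-α) - (u - (s + i * δ)) ^ (-α)) *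
      (((k:ℝ) - i) * δ) ^ γ ≤ C + δ ^ γ * (u - (s + k * δ)) ^ (-α) := by
    have t0 : 0 ≤ δ ^ γ * (u - (s + k * δ)) ^ (-α) :=
      mul_nonneg (Real.rpow_nonneg hδ.le _) (Real.rpow_nonneg (hpos k le_rfl).le _)
    cases k with
    | zero => simpa using add_nonneg hC0 (by simpa using t0)
    | succ j =>
      rw [Finset.sum_range_succ]
      refine add_le_add ?_ ?_
      · calc _ ≤ ∑ i ∈ Finset.range j, C * ((u - (s + i * δ)) ^ (γ - α) -
              (u - (s + (i+1:ℕ) * δ)) ^ (γ - α)) := by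
              refine Finset.sum_le_sum fun i hi => ?_
              have hi' : i < j := Finset.mem_range.1 hi
              have hij : (i:ℝ) + 1 ≤ j := by exact_mod_cast hi'
              have p1 := hpos (i+1) (by omega)
              have p0 := hpos i (by omega)
              have := hC (u - (s + i * δ)) (u - (s + (i+1:ℕ) * δ)) p1
                (by push_cast; nlinarith) (by push_cast at hku ⊢; nlinarith)
              refine le_trans ?_ this
              rw [mul_comm]
              refine mul_le_mul_of_nonneg_right ?_ (hmono i (by omega))
              refine Real.rpow_le_rpow ?_ ?_ (by linarith)
              · refine mul_nonneg ?_ hδ.le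
                push_cast; linarith
              · push_cast at hku ⊢; nlinarith
          _ = C * ((u - (s + (0:ℕ) * δ)) ^ (γ - α) - (u - (s + j * δ)) ^ (γ - α)) := by
              rw [← Finset.mul_sum, Finset.sum_range_sub' (fun i : ℕ => (u - (s + i * δ)) ^ (γ - α))]
          _ ≤ C * 1 := by
              refine mul_le_mul_of_nonneg_left ?_ hC0
              have a1 : 0 ≤ (u - (s + j * δ)) ^ (γ - α) := Real.rpow_nonneg (hpos j (by omega)).le _
              have a2 : (u - (s + (0:ℕ) * δ)) ^ (γ - α) ≤ 1 :=
                Real.rpow_le_one (hpos 0 (by omega)).le (by push_cast; linarith) (by linarith)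
              linarith
          _ = C := mul_one C
      · have : (((j+1:ℕ):ℝ) - j) * δ = δ := by push_cast; ring
        rw [this, mul_comm]
        refine mul_le_mul_of_nonneg_left ?_ (Real.rpow_nonneg hδ.le _)
        have : 0 ≤ (u - (s + j * δ)) ^ (-α) := Real.rpow_nonneg (hpos j (by omega)).le _
        linarith
  have h1 : ‖tpow (-α) (u - (s + (0:ℕ) * δ)) • b k‖ ≤ S * (u - s) ^ (-α) := by
    have hp := hpos 0 (by omega)
    rw [hw 0 (by omega), norm_smul, Real.norm_of_nonneg (Real.rpow_nonneg hp.le _), mul_comm]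
    simp only [Nat.cast_zero, zero_mul, add_zero] at hp ⊢
    exact mul_le_mul_of_nonneg_right hbS (Real.rpow_nonneg hp.le _)
  have h2 : ‖∑ i ∈ Finset.range k, (tpow (-α) (u - (s + (i+1:ℕ) * δ)) - tpow (-α) (u - (s + i * δ)))
      • (b k - b i)‖ ≤ L * (C + δ ^ γ * (u - (s + k * δ)) ^ (-α)) := by
    refine (norm_sum_le _ _).trans ?_
    refine le_trans ?_ (mul_le_mul_of_nonneg_left hsum hL)
    rw [Finset.mul_sum]
    refine Finset.sum_le_sum fun i hi => ?_
    have hi' : i < k := Finset.mem_range.1 hi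
    rw [hw i hi'.le, hw (i+1) hi', norm_smul, Real.norm_of_nonneg (hmono i hi')]
    calc _ ≤ _ := mul_le_mul_of_nonneg_left (hb i hi') (hmono i hi')
      _ = _ := by ring
  calc _ ≤ _ := norm_add_le _ _
    _ ≤ S * (u - s) ^ (-α) + L * (C + δ ^ γ * (u - (s + k * δ)) ^ (-α)) := add_le_add h1 h2
    _ = _ := by ring

lemma exists_cell {s t δ u : ℝ} {N : ℕ} (hδ : 0 < δ) (hN : s + N * δ = t) (hu : u ∈ Ioc s t) :
    ∃ k : ℕ, k < N ∧ s + k * δ < u ∧ u ≤ s + (k+1) * δ := by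
  have hx : 0 < (u - s) / δ := div_pos (by linarith [hu.1]) hδ
  have hc : 0 < ⌈(u - s) / δ⌉₊ := Nat.ceil_pos.2 hx
  obtain ⟨k, hk⟩ : ∃ k, ⌈(u - s) / δ⌉₊ = k + 1 := ⟨_, (Nat.succ_pred_eq_of_pos hc).symm⟩
  refine ⟨k, ?_, ?_, ?_⟩
  · have : ⌈(u - s) / δ⌉₊ ≤ N := by
      rw [Nat.ceil_le, div_le_iff₀ hδ]; linarith [hu.2]
    omega
  · have : (k:ℝ) < (u - s) / δ := Nat.lt_ceil.1 (by omega)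
    rw [lt_div_iff₀ hδ] at this; linarith
  · have := Nat.le_ceil ((u - s) / δ)
    rw [hk, div_le_iff₀ hδ] at this; push_cast at this; linarith

lemma sum_cell {E : Type*} [AddCommGroup E] [Module ℝ E] {s δ u : ℝ} {N k : ℕ} (hδ : 0 < δ)
    (hk : k < N) (hu : u ≤ s + (k+1) * δ) (b : ℝ) (d : ℕ → E) :
    ∑ i ∈ Finset.range N, tpow b (u - (s + i * δ)) • d i =
      ∑ i ∈ Finset.range (k+1), tpow b (u - (s + i * δ)) • d i := by
  symm
  refine Finset.sum_subset (Finset.range_mono hk) fun i _ hi => ?_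
  have : (k:ℝ) + 1 ≤ i := by
    have : k + 1 ≤ i := by simpa using hi
    exact_mod_cast this
  rw [tpow_of_nonpos (by nlinarith), zero_smul]

lemma h_L2 {E : Type*} [NormedAddCommGroup E] [NormedSpace ℝ E] {α γ C : ℝ} (h0 : 0 < α)
    (h1 : α < 1 / 2) (hγ : α < γ) (hC0 : 0 ≤ C)
    (hC : ∀ A B : ℝ, 0 < B → B ≤ A → A ≤ 2 * B →
      A ^ γ * (B ^ (-α) - A ^ (-α)) ≤ C * (A ^ (γ - α) - B ^ (γ - α)))
    {s t δ S L : ℝ} {N : ℕ} (hδ : 0 < δ) (hst : s < t) (hst1 : t ≤ s + 1) (hN : s + N * δ = t)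
    (b : ℕ → E) (hL : 0 ≤ L) (hbS : ∀ k < N, ‖b k‖ ≤ S)
    (hb : ∀ k < N, ∀ i < k, ‖b k - b i‖ ≤ L * (((k:ℝ) - i) * δ) ^ γ) :
    ∃ Θ : ℝ → ℝ, Integrable Θ ∧ (∀ u, 0 ≤ Θ u) ∧
      ∫ u, Θ u ≤ 3 * (2 / (1 - 2 * α) + C ^ 2) * (S ^ 2 + L ^ 2) * (t - s) ^ (1 - 2 * α) ∧
      ∀ u ∈ Ioc s t, ‖∑ i ∈ Finset.range N, tpow (-α) (u - (s + i * δ)) •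
        (b i - if i = 0 then 0 else b (i-1))‖ ^ 2 ≤ Θ u := by
  set P : ℝ → ℝ → ℝ := fun d => (Ioc 0 d).indicator fun x : ℝ => x ^ (-2 * α) with hP
  have P0 : ∀ d x, 0 ≤ P d x := fun d x => indicator_nonneg (fun y hy => Real.rpow_nonneg hy.1.le _) _
  have Pi : ∀ d, 0 ≤ d → Integrable (P d) ∧ ∫ x, P d x = d ^ (-2 * α + 1) / (-2 * α + 1) :=
    fun d hd => ipow_integral (by linarith) hd
  set τ := t - s with hτ
  have hτ0 : 0 < τ := by linarith
  have hτ1 : τ ≤ 1 := by linarith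
  set Q : ℝ → ℝ := (Ioc s t).indicator fun _ => (1:ℝ) with hQ
  have Qi : Integrable Q := by
    rw [hQ, integrable_indicator_iff measurableSet_Ioc]; exact integrableOn_const (by simp)
  have Qv : ∫ x, Q x = τ := by
    rw [hQ, integral_indicator measurableSet_Ioc]; simp [hst.le, hτ]
  have Q0 : ∀ x, 0 ≤ Q x := fun x => indicator_nonneg (fun _ _ => zero_le_one) _
  have I1 : Integrable fun u => S ^ 2 * P τ (u - s) := ((Pi τ hτ0.le).1.comp_sub_right s).const_mul _
  have I2 : Integrable fun u => L ^ 2 * C ^ 2 * Q u := Qi.const_mul _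
  have I3' : ∀ k ∈ Finset.range N, Integrable fun u => P δ (u - (s + k * δ)) :=
    fun k _ => (Pi δ hδ.le).1.comp_sub_right _
  have I3 : Integrable fun u => L ^ 2 * δ ^ (2 * α) * ∑ k ∈ Finset.range N, P δ (u - (s + k * δ)) :=
    (integrable_finsetSum _ I3').const_mul _
  refine ⟨fun u => 3 * (S ^ 2 * P τ (u - s) + L ^ 2 * C ^ 2 * Q u +
      L ^ 2 * δ ^ (2 * α) * ∑ k ∈ Finset.range N, P δ (u - (s + k * δ))),
      ((I1.add I2).add I3).const_mul 3, fun u => ?_, ?_, ?_⟩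
  · have a1 := P0 τ (u - s)
    have a2 := Q0 u
    have a3 : 0 ≤ ∑ k ∈ Finset.range N, P δ (u - (s + k * δ)) := Finset.sum_nonneg fun k _ => P0 _ _
    positivity
  · rw [integral_const_mul, integral_add (f := fun u => S ^ 2 * P τ (u - s) + L ^ 2 * C ^ 2 * Q u) (I1.add I2) I3,
      integral_add I1 I2, integral_const_mul,
      integral_const_mul, integral_const_mul, integral_finsetSum _ I3', Qv,
      integral_sub_right_eq_self (P τ) s, (Pi τ hτ0.le).2]
    simp only [integral_sub_right_eq_self (P δ), (Pi δ hδ.le).2]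
    rw [Finset.sum_const, Finset.card_range, nsmul_eq_mul]
    have e1 : L ^ 2 * δ ^ (2 * α) * (N * (δ ^ (-2 * α + 1) / (-2 * α + 1))) =
        L ^ 2 * τ / (1 - 2 * α) := by
      have : δ ^ (2 * α) * δ ^ (-2 * α + 1) = δ := by
        rw [← Real.rpow_add hδ]; ring_nf; simp
      have h2 : τ = N * δ := by rw [hτ]; linarith
      rw [h2, show -2 * α + 1 = 1 - 2 * α by ring] at *
      calc _ = L ^ 2 * N * (δ ^ (2 * α) * δ ^ (1 - 2 * α)) / (1 - 2 * α) := by ring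
        _ = _ := by rw [this]; ring
    rw [e1, show -2 * α + 1 = 1 - 2 * α by ring]
    have hT : τ ≤ τ ^ (1 - 2 * α) := by
      calc τ = τ ^ (1:ℝ) := (Real.rpow_one _).symm
        _ ≤ _ := Real.rpow_le_rpow_of_exponent_ge hτ0 hτ1 (by linarith)
    set T := τ ^ (1 - 2 * α) with hTd
    have hc : 0 < 1 - 2 * α := by linarith
    have hT0 : 0 ≤ T := hτ0.le.trans hT
    have hi : 0 < 1 / (1 - 2 * α) := by positivity
    have q1 : S ^ 2 * (T / (1 - 2 * α)) = S ^ 2 * T * (1 / (1 - 2 * α)) := by ring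
    have q2 : L ^ 2 * τ / (1 - 2 * α) ≤ L ^ 2 * T * (1 / (1 - 2 * α)) := by
      rw [div_eq_mul_one_div]
      exact mul_le_mul_of_nonneg_right (mul_le_mul_of_nonneg_left hT (sq_nonneg _)) hi.le
    have q3 : L ^ 2 * C ^ 2 * τ ≤ L ^ 2 * C ^ 2 * T := mul_le_mul_of_nonneg_left hT (by positivity)
    have q4 : 0 ≤ S ^ 2 * C ^ 2 * T := by positivity
    have q5 : 0 ≤ S ^ 2 * T * (1 / (1 - 2 * α)) := by positivity
    have q6 : 0 ≤ L ^ 2 * T * (1 / (1 - 2 * α)) := by positivity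
    have q7 : 2 / (1 - 2 * α) = 2 * (1 / (1 - 2 * α)) := by ring
    rw [q1, q7]
    nlinarith
  · intro u hu
    obtain ⟨k, hk, hk1, hk2⟩ := exists_cell hδ hN hu
    rw [sum_cell hδ hk hk2]
    have hB := pw_bound h0 hγ hC0 hC hδ b k hL hk1 (by linarith [hu.2]) (hbS k hk) (hb k hk)
    have sq : ∀ x : ℝ, 0 < x → (x ^ (-α)) ^ 2 = x ^ (-2 * α) := by
      intro x hx
      rw [← Real.rpow_natCast, ← Real.rpow_mul hx.le]; congr 1; push_cast; ring
    have us : 0 < u - s := by linarith [hu.1]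
    have uk : 0 < u - (s + k * δ) := by linarith
    have b1 : (S * (u - s) ^ (-α)) ^ 2 = S ^ 2 * P τ (u - s) := by
      rw [mul_pow, sq _ us, hP]; simp only
      rw [indicator_of_mem (show u - s ∈ Ioc 0 τ from ⟨us, by linarith [hu.2]⟩)]
    have b2 : (L * C) ^ 2 = L ^ 2 * C ^ 2 * Q u := by
      rw [hQ, indicator_of_mem hu]; ring
    have hδ1 : δ ≤ 1 := by
      have : (1:ℝ) ≤ N := by exact_mod_cast (by omega : 1 ≤ N)
      nlinarith
    have b3 : (L * δ ^ γ * (u - (s + k * δ)) ^ (-α)) ^ 2 ≤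
        L ^ 2 * δ ^ (2 * α) * ∑ k ∈ Finset.range N, P δ (u - (s + k * δ)) := by
      rw [mul_pow, sq _ uk, mul_pow]
      have c1 : (u - (s + k * δ)) ^ (-2 * α) = P δ (u - (s + k * δ)) := by
        rw [hP]; simp only
        rw [indicator_of_mem (show u - (s + k * δ) ∈ Ioc 0 δ from ⟨uk, by linarith⟩)]
      have c2 : P δ (u - (s + k * δ)) ≤ ∑ k ∈ Finset.range N, P δ (u - (s + k * δ)) :=
        Finset.single_le_sum (f := fun k : ℕ => P δ (u - (s + k * δ)))
          (fun i _ => P0 _ _) (Finset.mem_range.2 hk)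
      have c3 : (δ ^ γ) ^ 2 ≤ δ ^ (2 * α) := by
        rw [← Real.rpow_natCast, ← Real.rpow_mul hδ.le]
        exact Real.rpow_le_rpow_of_exponent_ge hδ hδ1 (by push_cast; linarith)
      rw [c1]
      exact mul_le_mul (mul_le_mul_of_nonneg_left c3 (sq_nonneg _)) c2 (P0 _ _) (by positivity)
    calc _ ≤ (S * (u - s) ^ (-α) + L * C + L * δ ^ γ * (u - (s + k * δ)) ^ (-α)) ^ 2 :=
          pow_le_pow_left₀ (norm_nonneg _) hB 2
      _ ≤ 3 * ((S * (u - s) ^ (-α)) ^ 2 + (L * C) ^ 2 + (L * δ ^ γ * (u - (s + k * δ)) ^ (-α)) ^ 2) := by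
          set x := S * (u - s) ^ (-α)
          set y := L * C
          set z := L * δ ^ γ * (u - (s + k * δ)) ^ (-α)
          nlinarith [sq_nonneg (x - y), sq_nonneg (y - z), sq_nonneg (x - z)]
      _ ≤ _ := by
          rw [b1, b2]; linarith

set_option maxHeartbeats 2000000 in
lemma core {E : Type*} [NormedAddCommGroup E] [InnerProductSpace ℝ E] [CompleteSpace E]
    {α γ ε : ℝ} (h0 : 0 < α) (h1 : α < 1 / 2) (hγ : α < γ) (hε : 0 < ε) :
    ∃ C₁ : ℝ, 0 < C₁ ∧ ∀ (f : ℝ → E) (S L m s t : ℝ), ε ≤ s → s < t → t ≤ 1 → 0 < m → 0 ≤ L →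
      (∀ u ∈ Icc (0:ℝ) 1, m ≤ ‖f u‖ ∧ ‖f u‖ ≤ S) → ContinuousOn f (Icc 0 1) →
      (∀ u v, 0 ≤ u → u < v → v ≤ 1 → ‖f v - f u‖ ≤ L * (v - u) ^ γ) →
      IntegrableOn (fun u => ‖∫ v, tpow (α - 1) (v - u) •
          (Ioc s t).indicator (fun v => v ^ α • f v) v‖ ^ 2) (Ioc s t) ∧
      C₁ * (t - s) ^ (1 + 2 * α) * m ^ 4 / (S ^ 2 + L ^ 2) ≤
        ∫ u in Ioc s t, ‖∫ v, tpow (α - 1) (v - u) •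
          (Ioc s t).indicator (fun v => v ^ α • f v) v‖ ^ 2 := by
  obtain ⟨C, hC0, hC⟩ := pow_compare h0 hγ
  set A := 3 * (2 / (1 - 2 * α) + C ^ 2) with hA
  have hA0 : 0 < A := by
    have : 0 < 1 - 2 * α := by linarith
    positivity
  have hB1 : 1 ≤ betaC α := betaC_ge h0 (by linarith)
  refine ⟨(betaC α * ε ^ α / 2) ^ 2 / A, by positivity, ?_⟩
  intro f S L m s t hs hst ht hm hL hf hfc hfL
  set q : ℝ → E := (Ioc s t).indicator (fun v => v ^ α • f v) with hq
  set G : ℝ → E := fun u => ∫ v, tpow (α - 1) (v - u) • q v with hG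
  have hs0 : 0 < s := by linarith
  have hsub : Icc s t ⊆ Icc (0:ℝ) 1 := Icc_subset_Icc hs0.le ht
  have hsub' : Ioc s t ⊆ Icc (0:ℝ) 1 := Ioc_subset_Icc_self.trans hsub
  have hS0 : 0 < S := by
    have := hf 0 ⟨le_rfl, zero_le_one⟩; linarith
  have hqi : Integrable q := by
    rw [hq, integrable_indicator_iff measurableSet_Ioc]
    refine IntegrableOn.mono_set ?_ Ioc_subset_Icc_self
    refine ContinuousOn.integrableOn_Icc ?_
    refine ContinuousOn.smul ?_ (hfc.mono hsub)
    exact (Real.continuous_rpow_const h0.le).continuousOn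
  have hqS : ∀ v, ‖q v‖ ≤ S := by
    intro v
    by_cases hv : v ∈ Ioc s t
    · rw [hq, indicator_of_mem hv, norm_smul]
      have hv0 : 0 ≤ v := (hsub' hv).1
      rw [Real.norm_of_nonneg (Real.rpow_nonneg hv0 _)]
      have := (hf v (hsub' hv)).2
      have h2 : v ^ α ≤ 1 := Real.rpow_le_one hv0 (hsub' hv).2 h0.le
      have h3 : 0 ≤ v ^ α := Real.rpow_nonneg hv0 _
      nlinarith [norm_nonneg (f v)]
    · rw [hq, indicator_of_notMem hv, norm_zero]; exact hS0.le
  have hker : ∀ u ∈ Ioc s t, ∀ v, ‖tpow (α - 1) (v - u) • q v‖ ≤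
      S * (Ioc 0 1).indicator (fun x : ℝ => x ^ (α - 1)) (v - u) := by
    intro u hu v
    rw [norm_smul, Real.norm_of_nonneg (tpow_nonneg _ _)]
    have n0 : 0 ≤ (Ioc 0 1).indicator (fun x : ℝ => x ^ (α - 1)) (v - u) :=
      indicator_nonneg (fun y hy => Real.rpow_nonneg hy.1.le _) _
    rcases le_or_gt v u with h | h
    · rw [tpow_of_nonpos (by linarith), zero_mul]; positivity
    by_cases hv : v ∈ Ioc s t
    · rw [indicator_of_mem (show v - u ∈ Ioc (0:ℝ) 1 from ⟨by linarith, by linarith [hv.2, hu.1]⟩), tpow_of_pos (by linarith), mul_comm]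
      exact mul_le_mul_of_nonneg_right (hqS v) (Real.rpow_nonneg (by linarith) _)
    · rw [hq, indicator_of_notMem hv, norm_zero, mul_zero]; positivity
  have ib := ipow_integral (b := α - 1) (d := 1) (by linarith) zero_le_one
  have kerm : AEStronglyMeasurable (fun z : ℝ × ℝ => tpow (α - 1) (z.2 - z.1) • q z.2)
      (volume.prod volume) := by
    refine AEStronglyMeasurable.smul ?_ hqi.1.comp_snd
    exact ((measurable_tpow _).comp (measurable_snd.sub measurable_fst)).aestronglyMeasurable
  have Gm : AEStronglyMeasurable G := kerm.integral_prod_right'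
  have keri : ∀ u ∈ Ioc s t, Integrable fun v => tpow (α - 1) (v - u) • q v := by
    intro u hu
    refine ((ib.1.comp_sub_right u).const_mul S).mono' ?_ (Filter.Eventually.of_forall (hker u hu))
    exact (((measurable_tpow _).comp (measurable_id.sub measurable_const)).aestronglyMeasurable).smul hqi.1
  have Gb : ∀ u ∈ Ioc s t, ‖G u‖ ≤ S * (1 / α) := by
    intro u hu
    have := norm_integral_le_of_norm_le ((ib.1.comp_sub_right u).const_mul S)
      (Filter.Eventually.of_forall (hker u hu))
    rw [integral_const_mul, integral_sub_right_eq_self _ u, ib.2] at this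
    simpa using this
  have GI : IntegrableOn (fun u => ‖G u‖ ^ 2) (Ioc s t) := by
    refine Measure.integrableOn_of_bounded (M := (S * (1 / α)) ^ 2) (by simp) (Gm.norm.pow 2) ?_
    refine (ae_restrict_iff' measurableSet_Ioc).2 (Filter.Eventually.of_forall fun u hu => ?_)
    rw [Real.norm_of_nonneg (by positivity)]
    exact pow_le_pow_left₀ (norm_nonneg _) (Gb u hu) 2
  refine ⟨GI, ?_⟩
  -- choice of N
  obtain ⟨N, hN0, hNs⟩ : ∃ N : ℕ, 0 < N ∧ L * ((t - s) / N) ^ γ ≤ m / 2 := by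
    have l1 : Filter.Tendsto (fun N : ℕ => L * ((t - s) / N) ^ γ) Filter.atTop (nhds (L * 0 ^ γ)) := by
      refine Filter.Tendsto.const_mul _ ?_
      exact (tendsto_const_div_atTop_nhds_zero_nat (t - s)).rpow_const (Or.inr (by linarith))
    rw [Real.zero_rpow (by linarith), mul_zero] at l1
    obtain ⟨N, h1, h2⟩ := ((l1.eventually_le_const (by positivity : 0 < m / 2)).and
      (Filter.eventually_gt_atTop 0)).exists
    exact ⟨N, h2, h1⟩
  have hNR : (0:ℝ) < N := by exact_mod_cast hN0
  set δ := (t - s) / N with hδd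
  have hδ : 0 < δ := div_pos (by linarith) hNR
  have hN : s + N * δ = t := by rw [hδd]; field_simp; ring
  set b : ℕ → E := fun i => f (s + i * δ) with hb
  set d : ℕ → E := fun i => b i - if i = 0 then 0 else b (i-1) with hd
  have hpt : ∀ k < N, s + k * δ ∈ Icc (0:ℝ) 1 := by
    intro k hk
    have : (k:ℝ) ≤ N := by exact_mod_cast hk.le
    constructor
    · positivity
    · nlinarith
  obtain ⟨Θ, Θi, Θ0, Θint, hΘ⟩ := h_L2 h0 h1 hγ hC0 hC (S := S) (L := L) hδ hst (by linarith) hN b hL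
    (fun k hk => (hf _ (hpt k hk)).2) (by
      intro k hk i hi
      have hik : (i:ℝ) < k := by exact_mod_cast hi
      have := hfL (s + i * δ) (s + k * δ) (hpt i (hi.trans hk)).1 (by nlinarith) (hpt k hk).2
      rwa [show s + k * δ - (s + i * δ) = ((k:ℝ) - i) * δ by ring] at this)
  set h : ℝ → E := fun u => ∑ i ∈ Finset.range N, tpow (-α) (u - (s + i * δ)) • d i with hh
  -- duality identity
  have dual : ∀ i : ℕ, IntegrableOn (fun u => tpow (-α) (u - (s + i * δ)) * inner ℝ (d i) (G u)) (Ioc s t) ∧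
      ∫ u in Ioc s t, tpow (-α) (u - (s + i * δ)) * inner ℝ (d i) (G u) =
        betaC α * ∫ v in Ioc s t, tpow 0 (v - (s + i * δ)) * inner ℝ (d i) (q v) := by
    intro i
    have hqd : Integrable fun v => inner ℝ (d i) (q v) := hqi.const_inner (d i)
    obtain ⟨f1, f2⟩ := fubini_beta h0 (by linarith) (s + i * δ) _ hqd
    set R : ℝ → ℝ := fun u => tpow (-α) (u - (s + i * δ)) *
      ∫ v, tpow (α - 1) (v - u) * inner ℝ (d i) (q v) with hR
    have eR : EqOn R (fun u => tpow (-α) (u - (s + i * δ)) * inner ℝ (d i) (G u)) (Ioc s t) := by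
      intro u hu
      simp only [hR, hG]
      rw [← integral_inner (keri u hu)]
      simp only [inner_smul_right]
    refine ⟨f1.integrableOn.congr_fun eR measurableSet_Ioc, ?_⟩
    rw [← setIntegral_congr_fun measurableSet_Ioc eR,
      setIntegral_eq_integral_of_forall_compl_eq_zero, f2]
    · congr 1
      rw [setIntegral_eq_integral_of_forall_compl_eq_zero]
      · congr 1; funext v
        unfold tpow
        by_cases hv : s + i * δ < v
        · rw [if_pos hv, if_pos (by linarith)]; simp
        · rw [if_neg hv, if_neg (by linarith)]; simp
      · intro v hv
        rw [hq, indicator_of_notMem hv]; simp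
    · intro u hu
      simp only [hR]
      rcases le_or_gt u s with h | h
      · rw [tpow_of_nonpos, zero_mul]
        have : 0 ≤ i * δ := by positivity
        linarith
      · have hut : t < u := by
          by_contra hc; exact hu ⟨h, not_lt.1 hc⟩
        have : (fun v => tpow (α - 1) (v - u) * inner ℝ (d i) (q v)) = fun _ => 0 := by
          funext v
          by_cases hv : v ∈ Ioc s t
          · rw [tpow_of_nonpos (by linarith [hv.2]), zero_mul]
          · rw [hq, indicator_of_notMem hv]; simp
        rw [this]; simp
  have hGi : IntegrableOn (fun u => inner ℝ (h u) (G u)) (Ioc s t) := by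
    simp only [hh, sum_inner, real_inner_smul_left]
    exact integrable_finsetSum _ fun i _ => (dual i).1
  have t0m : ∀ i : ℕ, IntegrableOn (fun v => tpow 0 (v - (s + i * δ)) * inner ℝ (d i) (q v)) (Ioc s t) := by
    intro i
    refine Integrable.integrableOn ?_
    refine (hqi.const_inner (d i)).bdd_mul (c := 1) ?_ (Filter.Eventually.of_forall fun v => ?_)
    · exact ((measurable_tpow _).comp (measurable_id.sub measurable_const)).aestronglyMeasurable
    · unfold tpow; split_ifs <;> simp
  have X : ∫ u in Ioc s t, inner ℝ (h u) (G u) =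
      betaC α * ∫ v in Ioc s t, inner ℝ (∑ i ∈ Finset.range N, tpow 0 (v - (s + i * δ)) • d i) (q v) := by
    simp only [hh, sum_inner, real_inner_smul_left]
    rw [integral_finsetSum _ fun i _ => (dual i).1, integral_finsetSum _ fun i _ => t0m i,
      Finset.mul_sum]
    exact Finset.sum_congr rfl fun i _ => (dual i).2
  have low : ∀ v ∈ Ioc s t, ε ^ α * (m ^ 2 / 2) ≤
      inner ℝ (∑ i ∈ Finset.range N, tpow 0 (v - (s + i * δ)) • d i) (q v) := by
    intro v hv
    obtain ⟨k, hk, hk1, hk2⟩ := exists_cell hδ hN hv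
    have e : ∑ i ∈ Finset.range N, tpow 0 (v - (s + i * δ)) • d i = b k := by
      rw [sum_cell hδ hk hk2]
      have : ∀ i ∈ Finset.range (k+1), tpow 0 (v - (s + i * δ)) • d i = (1:ℝ) • d i := by
        intro i hi
        have : (i:ℝ) ≤ k := by exact_mod_cast Nat.lt_succ_iff.1 (Finset.mem_range.1 hi)
        rw [tpow_of_pos (by nlinarith), Real.rpow_zero]
      rw [Finset.sum_congr rfl this, hd]
      have := abel (fun _ => (1:ℝ)) b k
      simpa using this
    have hv01 := hsub' hv
    rw [e, hq, indicator_of_mem hv, inner_smul_right]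
    have hbv : ‖f v - b k‖ ≤ m / 2 := by
      refine (hfL _ _ (hpt k hk).1 hk1 hv01.2).trans (le_trans ?_ hNs)
      refine mul_le_mul_of_nonneg_left ?_ hL
      exact Real.rpow_le_rpow (by linarith) (by linarith) (by linarith)
    have i1 : inner ℝ (b k) (f v) = ‖f v‖ ^ 2 - inner ℝ (f v - b k) (f v) := by
      rw [inner_sub_left, real_inner_self_eq_norm_sq]; ring
    have i2 := real_inner_le_norm (f v - b k) (f v)
    have i3 := (hf v hv01).1
    have i4 : m ^ 2 / 2 ≤ inner ℝ (b k) (f v) := by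
      rw [i1]; nlinarith
    exact mul_le_mul (Real.rpow_le_rpow hε.le (by linarith [hv.1]) h0.le) i4 (by positivity)
      (Real.rpow_nonneg hv01.1 _)
  set X0 := betaC α * (ε ^ α * (m ^ 2 / 2) * (t - s)) with hX0
  have XX : X0 ≤ ∫ u in Ioc s t, inner ℝ (h u) (G u) := by
    rw [X]
    refine mul_le_mul_of_nonneg_left ?_ (by linarith)
    have : ∫ v in Ioc s t, ε ^ α * (m ^ 2 / 2) = ε ^ α * (m ^ 2 / 2) * (t - s) := by
      rw [setIntegral_const]; simp [hst.le]; ring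
    rw [← this]
    refine setIntegral_mono_on (integrableOn_const (by simp)) ?_ measurableSet_Ioc low
    simp only [sum_inner, real_inner_smul_left]
    exact integrable_finsetSum _ fun i _ => t0m i
  have hts : 0 < t - s := by linarith
  have hX0p : 0 < X0 := by positivity
  set A0 := A * (S ^ 2 + L ^ 2) * (t - s) ^ (1 - 2 * α) with hA0d
  have hA0p : 0 < A0 := by positivity
  set lam := X0 / A0 with hlam
  have hlp : 0 < lam := by positivity
  have cs : 2 * ∫ u in Ioc s t, inner ℝ (h u) (G u) ≤ lam * A0 + lam⁻¹ * ∫ u in Ioc s t, ‖G u‖ ^ 2 := by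
    have st : ∫ u in Ioc s t, Θ u ≤ A0 :=
      (setIntegral_le_integral Θi (Filter.Eventually.of_forall Θ0)).trans Θint
    calc 2 * ∫ u in Ioc s t, inner ℝ (h u) (G u) = ∫ u in Ioc s t, 2 * inner ℝ (h u) (G u) :=
          (integral_const_mul _ _).symm
      _ ≤ ∫ u in Ioc s t, (lam * Θ u + lam⁻¹ * ‖G u‖ ^ 2) := by
          refine setIntegral_mono_on (hGi.const_mul 2)
            ((Θi.integrableOn.const_mul lam).add (GI.const_mul _)) measurableSet_Ioc fun u hu => ?_
          have j1 := real_inner_le_norm (h u) (G u)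
          have j2 := hΘ u hu
          have j3 : 2 * (‖h u‖ * ‖G u‖) ≤ lam * ‖h u‖ ^ 2 + lam⁻¹ * ‖G u‖ ^ 2 := by
            have : lam * ‖h u‖ ^ 2 + lam⁻¹ * ‖G u‖ ^ 2 - 2 * (‖h u‖ * ‖G u‖) =
              lam⁻¹ * (lam * ‖h u‖ - ‖G u‖) ^ 2 := by field_simp; ring
            have : 0 ≤ lam⁻¹ * (lam * ‖h u‖ - ‖G u‖) ^ 2 := by positivity
            linarith
          have j4 : lam * ‖h u‖ ^ 2 ≤ lam * Θ u := mul_le_mul_of_nonneg_left j2 hlp.le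
          linarith
      _ = lam * (∫ u in Ioc s t, Θ u) + lam⁻¹ * ∫ u in Ioc s t, ‖G u‖ ^ 2 := by
          rw [integral_add (Θi.integrableOn.const_mul lam) (GI.const_mul _), integral_const_mul,
            integral_const_mul]
      _ ≤ _ := by
          have := mul_le_mul_of_nonneg_left st hlp.le
          linarith
  have fin : X0 ^ 2 / A0 ≤ ∫ u in Ioc s t, ‖G u‖ ^ 2 := by
    have k1 : lam * A0 = X0 := by rw [hlam]; field_simp
    have k2 : X0 ≤ lam⁻¹ * ∫ u in Ioc s t, ‖G u‖ ^ 2 := by linarith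
    have k3 := mul_le_mul_of_nonneg_left k2 hlp.le
    rw [mul_inv_cancel_left₀ hlp.ne'] at k3
    calc _ = lam * X0 := by rw [hlam]; ring
      _ ≤ _ := k3
  refine le_trans (le_of_eq ?_) fin
  have ee : (t - s) ^ (1 + 2 * α) * (t - s) ^ (1 - 2 * α) = (t - s) ^ 2 := by
    rw [← Real.rpow_add hts, ← Real.rpow_natCast]; congr 1; push_cast; ring
  have hp1 : 0 < (t - s) ^ (1 - 2 * α) := by positivity
  have hSL : 0 < S ^ 2 + L ^ 2 := by positivity
  rw [hA0d, hX0, eq_div_iff (by positivity)]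
  calc _ = (betaC α * ε ^ α / 2) ^ 2 * m ^ 4 * ((t - s) ^ (1 + 2 * α) * (t - s) ^ (1 - 2 * α)) *
        (A / A) * ((S ^ 2 + L ^ 2) / (S ^ 2 + L ^ 2)) := by ring
    _ = _ := by rw [ee, div_self hA0.ne', div_self hSL.ne']; ring

/-- For `H ∈ (1/2,1)`, `ε ∈ (0,1)` and `γ > H - 1/2` there is `C₁ > 0`
such that for every `γ`-Hölder `f : [0,1] → ℝⁿ` and all `ε ≤ s < t ≤ 1`,
`C₁ (t-s)^{2H} (min |f|)⁴ / (‖f‖_∞² + ‖f‖_γ²)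
  ≤ ∫ₛᵗ | ∫ᵤᵗ ∂_v K(v,u) f(v) dv |² du`. -/
theorem stmt9 (n : ℕ) (H ε γ : ℝ) (hH : 1 / 2 < H) (hH1 : H < 1)
    (hε0 : 0 < ε) (hε1 : ε < 1) (hγ : H - 1 / 2 < γ) :
    ∃ C₁ : ℝ, 0 < C₁ ∧
      ∀ f : ℝ → EuclideanSpace ℝ (Fin n),
        (∃ K : ℝ, ∀ u ∈ Set.Icc (0 : ℝ) 1, ∀ v ∈ Set.Icc (0 : ℝ) 1,
            ‖f v - f u‖ ≤ K * |v - u| ^ γ) →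
        ∀ s t : ℝ, ε ≤ s → s < t → t ≤ 1 →
          C₁ * (t - s) ^ (2 * H) * minNorm01 f ^ 4
              / (supNorm01 f ^ 2 + holderNorm01 γ f ^ 2)
            ≤ ∫ u in s..t, ‖∫ v in u..t, volterraKernelDeriv H v u • f v‖ ^ 2 := by
  obtain ⟨C₁, hC₁, hcore⟩ := core (E := EuclideanSpace ℝ (Fin n)) (α := H - 1 / 2) (γ := γ) (ε := ε)
    (by linarith) (by linarith) hγ hε0
  refine ⟨C₁, hC₁, ?_⟩
  rintro f ⟨K, hK⟩ s t hs hst ht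
  have hγ0 : 0 < γ := by linarith
  have hs0 : 0 < s := by linarith
  have hfc : ContinuousOn f (Icc 0 1) := by
    intro u hu
    rw [ContinuousWithinAt, tendsto_iff_norm_sub_tendsto_zero]
    have l : Filter.Tendsto (fun v : ℝ => K * |v - u| ^ γ) (nhdsWithin u (Icc 0 1)) (nhds 0) := by
      have : Continuous fun v : ℝ => K * |v - u| ^ γ :=
        continuous_const.mul ((continuous_id.sub continuous_const).abs.rpow_const
          fun _ => Or.inr hγ0.le)
      have h2 := this.tendsto u
      simp only [sub_self, abs_zero, Real.zero_rpow hγ0.ne', mul_zero] at h2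
      exact h2.mono_left nhdsWithin_le_nhds
    refine squeeze_zero' (Filter.Eventually.of_forall fun v => norm_nonneg _) ?_ l
    filter_upwards [self_mem_nhdsWithin] with v hv using hK u hu v hv
  have hcomp : IsCompact ((fun u => ‖f u‖) '' Icc (0:ℝ) 1) := isCompact_Icc.image_of_continuousOn hfc.norm
  have hf : ∀ u ∈ Icc (0:ℝ) 1, minNorm01 f ≤ ‖f u‖ ∧ ‖f u‖ ≤ supNorm01 f := fun u hu =>
    ⟨csInf_le hcomp.bddBelow (mem_image_of_mem _ hu), le_csSup hcomp.bddAbove (mem_image_of_mem _ hu)⟩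
  have hm0 : 0 ≤ minNorm01 f := by
    refine Real.sInf_nonneg ?_
    rintro _ ⟨u, _, rfl⟩; exact norm_nonneg _
  have hL0 : 0 ≤ holderNorm01 γ f := by
    refine Real.sSup_nonneg ?_
    rintro _ ⟨u, v, _, huv, _, rfl⟩
    exact div_nonneg (norm_nonneg _) (Real.rpow_nonneg (by linarith) _)
  have hL : ∀ u v, 0 ≤ u → u < v → v ≤ 1 → ‖f v - f u‖ ≤ holderNorm01 γ f * (v - u) ^ γ := by
    intro u v hu huv hv
    have hp : 0 < (v - u) ^ γ := Real.rpow_pos_of_pos (by linarith) _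
    rw [← div_le_iff₀ hp]
    refine le_csSup ⟨K, ?_⟩ ⟨u, v, hu, huv, hv, rfl⟩
    rintro _ ⟨u, v, hu, huv, hv, rfl⟩
    rw [div_le_iff₀ (Real.rpow_pos_of_pos (by linarith) _)]
    have := hK u ⟨hu, by linarith⟩ v ⟨by linarith, hv⟩
    rwa [abs_of_pos (by linarith)] at this
  rcases hm0.eq_or_lt with hm | hm
  · rw [← hm]
    simp only [ne_eq, OfNat.ofNat_ne_zero, not_false_eq_true, zero_pow, mul_zero, zero_div]
    exact intervalIntegral.integral_nonneg hst.le fun u _ => by positivity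
  obtain ⟨GI, hb⟩ := hcore f _ _ _ s t hs hst ht hm hL0 hf hfc hL
  rw [show 1 + 2 * (H - 1 / 2) = 2 * H by ring] at hb
  refine hb.trans ?_
  rw [intervalIntegral.integral_of_le hst.le]
  set G : ℝ → EuclideanSpace ℝ (Fin n) := fun u => ∫ v, tpow (H - 1 / 2 - 1) (v - u) •
          (Ioc s t).indicator (fun v => v ^ (H - 1 / 2) • f v) v with hG
  have key : ∀ u ∈ Ioc s t, ‖∫ v in u..t, volterraKernelDeriv H v u • f v‖ ^ 2 =
      (u ^ (1 / 2 - H)) ^ 2 * ‖G u‖ ^ 2 := by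
    intro u hu
    have hu0 : 0 < u := by linarith [hu.1]
    have e : ∫ v in u..t, volterraKernelDeriv H v u • f v = u ^ (1 / 2 - H) • G u := by
      rw [hG]; simp only
      rw [← integral_smul, intervalIntegral.integral_of_le hu.2, ← integral_indicator measurableSet_Ioc]
      congr 1; funext v
      by_cases hv : v ∈ Ioc u t
      · rw [indicator_of_mem hv, indicator_of_mem (show v ∈ Ioc s t from ⟨hu.1.trans hv.1, hv.2⟩),
          tpow_of_pos (by linarith [hv.1]), smul_smul, smul_smul, volterraKernelDeriv,
          show H - 1 / 2 - 1 = H - 3 / 2 by ring, mul_assoc]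
      · rw [indicator_of_notMem hv]
        rcases le_or_gt v u with h | h
        · rw [tpow_of_nonpos (by linarith), zero_smul, smul_zero]
        · rw [indicator_of_notMem (show v ∉ Ioc s t from fun h' => hv ⟨h, h'.2⟩), smul_zero, smul_zero]
    rw [e, norm_smul, mul_pow, Real.norm_of_nonneg (Real.rpow_nonneg hu0.le _)]
  rw [setIntegral_congr_fun measurableSet_Ioc key]
  refine setIntegral_mono_on GI ?_ measurableSet_Ioc fun u hu => ?_
  · refine Integrable.bdd_mul (c := (s ^ (1 / 2 - H)) ^ 2) GI ?_ ?_
    · exact (Measurable.aestronglyMeasurable (by fun_prop))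
    · refine (ae_restrict_iff' measurableSet_Ioc).2 (Filter.Eventually.of_forall fun u hu => ?_)
      have hu0 : 0 < u := by linarith [hu.1]
      rw [Real.norm_of_nonneg (by positivity)]
      exact pow_le_pow_left₀ (Real.rpow_nonneg hu0.le _)
        (Real.rpow_le_rpow_of_nonpos hs0 hu.1.le (by linarith)) 2
  · have hu0 : 0 < u := by linarith [hu.1]
    have : 1 ≤ u ^ (1 / 2 - H) := Real.one_le_rpow_of_pos_of_le_one_of_nonpos hu0
      (by linarith [hu.2]) (by linarith)
    exact le_mul_of_one_le_left (by positivity) (one_le_pow₀ this)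
end

section
/- Let H ∈ (1/4, 1/2) and γ > 1/2 − H. There exists a constant C > 0 (depending only on H, γ) such that for every γ-Hölder continuous function f : [0,1] → ℝ: ∫₀¹ ( (1 − u)^{H − 1/2} f(u) + (H − 1/2) ∫ᵤ¹ (f(r) − f(u)) (r − u)^{H − 3/2} dr )² du ≥ C ∫₀¹ f(u)² du. -/
open MeasureTheory Set

noncomputable def NN (a : ℝ) (F : ℝ → ℝ) (u t : ℝ) : ℝ :=
  if u + t ≤ 1 then (F (u + t) - F u) * t ^ (-a - 1) else 0

noncomputable def DD (a : ℝ) (F : ℝ → ℝ) (u : ℝ) : ℝ :=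
  ∫ t in Ioc (0:ℝ) 1, NN a F u t

lemma NN_meas (a : ℝ) (F : ℝ → ℝ) (hF : Continuous F) :
    Measurable (fun p : ℝ × ℝ => NN a F p.1 p.2) := by
  unfold NN
  have h1 : Measurable F := hF.measurable
  refine Measurable.ite ?_ ?_ measurable_const
  · exact measurableSet_le (by fun_prop) (by fun_prop)
  · fun_prop

lemma NN_bound (a γ K : ℝ) (F : ℝ → ℝ) (hK : 0 ≤ K)
    (h : ∀ u v, |F v - F u| ≤ K * |v - u| ^ γ) (u t : ℝ) (ht : 0 < t) :
    ‖NN a F u t‖ ≤ K * t ^ (γ - a - 1) := by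
  unfold NN
  split_ifs
  · rw [norm_mul, Real.norm_eq_abs, Real.norm_eq_abs, abs_of_pos (Real.rpow_pos_of_pos ht _)]
    have := h u (u + t)
    rw [add_sub_cancel_left, abs_of_pos ht] at this
    calc _ ≤ K * t ^ γ * t ^ (-a - 1) := by gcongr
      _ = _ := by rw [mul_assoc, ← Real.rpow_add ht]; ring_nf
  · simp; positivity

lemma pow_int (c : ℝ) (hc : -1 < c) : IntegrableOn (fun t : ℝ => t ^ c) (Ioc 0 1) := by
  have := (intervalIntegral.intervalIntegrable_rpow' (a := 0) (b := 1) hc)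
  rwa [intervalIntegrable_iff_integrableOn_Ioc_of_le zero_le_one] at this

lemma NN_int1 (a γ K : ℝ) (haγ : a < γ) (F : ℝ → ℝ) (hF : Continuous F) (hK : 0 ≤ K)
    (h : ∀ u v, |F v - F u| ≤ K * |v - u| ^ γ) (u : ℝ) :
    IntegrableOn (NN a F u) (Ioc 0 1) := by
  refine Integrable.mono' ((pow_int (γ - a - 1) (by linarith)).const_mul K) ?_ ?_
  · exact ((NN_meas a F hF).comp (measurable_prodMk_left (x := u))).aestronglyMeasurable
  · filter_upwards [ae_restrict_mem measurableSet_Ioc] with t ht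
    exact NN_bound a γ K F hK h u t ht.1

lemma NN_int2 (a γ K : ℝ) (haγ : a < γ) (F : ℝ → ℝ) (hF : Continuous F) (hK : 0 ≤ K)
    (h : ∀ u v, |F v - F u| ≤ K * |v - u| ^ γ) :
    Integrable (Function.uncurry (NN a F))
      ((volume.restrict (Ioc (0:ℝ) 1)).prod (volume.restrict (Ioc (0:ℝ) 1))) := by
  have h1 : Integrable (fun _ : ℝ => (1:ℝ)) (volume.restrict (Ioc (0:ℝ) 1)) :=
    integrable_const 1
  have h2 := h1.mul_prod ((pow_int (γ - a - 1) (by linarith)).const_mul K)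
  refine Integrable.mono' h2 (NN_meas a F hF).aestronglyMeasurable ?_
  rw [Measure.prod_restrict]
  filter_upwards [ae_restrict_mem (measurableSet_Ioc.prod measurableSet_Ioc)] with p hp
  simpa [Function.uncurry] using NN_bound a γ K F hK h p.1 p.2 hp.2.1

lemma DD_eq (a : ℝ) (F : ℝ → ℝ) (u : ℝ) (hu : u ∈ Ioc (0:ℝ) 1) :
    DD a F u = ∫ r in u..1, (F r - F u) * (r - u) ^ (-a - 1) := by
  have h1 : ∫ r in u..1, (F r - F u) * (r - u) ^ (-a - 1)
      = ∫ t in (0:ℝ)..(1-u), (F (u + t) - F u) * t ^ (-a - 1) := by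
    have := intervalIntegral.integral_comp_add_left (a := 0) (b := 1 - u)
      (fun r => (F r - F u) * (r - u) ^ (-a - 1)) u
    simp only [add_sub_cancel_left, add_zero, add_sub_cancel] at this
    exact this.symm
  rw [h1, intervalIntegral.integral_of_le (by linarith [hu.2])]
  unfold DD
  have : ∀ t, NN a F u t = (Iic (1-u)).indicator
      (fun t => (F (u + t) - F u) * t ^ (-a - 1)) t := by
    intro t
    unfold NN
    by_cases h : u + t ≤ 1
    · rw [if_pos h, indicator_of_mem]; simp; linarith
    · rw [if_neg h, indicator_of_notMem]; simp; linarith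
  simp_rw [this]
  rw [setIntegral_indicator measurableSet_Iic, Ioc_inter_Iic, min_eq_right (by linarith [hu.1])]

lemma inner_swap (a : ℝ) (F : ℝ → ℝ) (hF : Continuous F) (hF0 : ∀ x, 0 ≤ F x)
    (t : ℝ) (ht : t ∈ Ioc (0:ℝ) 1) :
    ∫ u in Ioc (0:ℝ) 1, NN a F u t ≤ t ^ (-a - 1) * ∫ u in (1-t)..1, F u := by
  have : ∀ u, NN a F u t = (Iic (1-t)).indicator
      (fun u => (F (u + t) - F u) * t ^ (-a - 1)) u := by
    intro u
    unfold NN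
    by_cases h : u + t ≤ 1
    · rw [if_pos h, indicator_of_mem]; simp; linarith
    · rw [if_neg h, indicator_of_notMem]; simp; linarith
  simp_rw [this]
  rw [setIntegral_indicator measurableSet_Iic, Ioc_inter_Iic, min_eq_right (by linarith [ht.1]),
    ← intervalIntegral.integral_of_le (by linarith [ht.2]), intervalIntegral.integral_mul_const,
    mul_comm]
  refine mul_le_mul_of_nonneg_left ?_ (Real.rpow_nonneg ht.1.le _)
  have hi : ∀ x y, IntervalIntegrable F volume x y := fun x y => hF.intervalIntegrable x y
  have hs : Continuous (fun x => F (x + t)) := by fun_prop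
  rw [intervalIntegral.integral_sub (hs.intervalIntegrable _ _) (hi _ _),
    intervalIntegral.integral_comp_add_right]
  have e1 := intervalIntegral.integral_add_adjacent_intervals (hi 0 t) (hi t 1)
  have e2 := intervalIntegral.integral_add_adjacent_intervals (hi 0 (1-t)) (hi (1-t) 1)
  have e3 : 0 ≤ ∫ u in (0:ℝ)..t, F u :=
    intervalIntegral.integral_nonneg ht.1.le (fun x _ => hF0 x)
  simp only [zero_add, sub_add_cancel]
  linarith

lemma P_bound (M : ℝ) (F : ℝ → ℝ) (hM : ∀ x, |F x| ≤ M) (t : ℝ) (ht : 0 ≤ t) :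
    |∫ u in (1-t)..1, F u| ≤ M * t := by
  have := intervalIntegral.norm_integral_le_of_norm_le_const (a := 1-t) (b := 1) (f := F) (C := M)
    (fun x _ => hM x)
  simpa [abs_of_nonneg ht] using this

lemma J_int (a M : ℝ) (ha1 : a < 1) (F : ℝ → ℝ) (hF : Continuous F)
    (hM : ∀ x, |F x| ≤ M) :
    IntegrableOn (fun t => t ^ (-a - 1) * ∫ u in (1-t)..1, F u) (Ioc 0 1) := by
  have hP : Continuous (fun t : ℝ => ∫ u in (1-t)..1, F u) := by
    have h0 : Continuous (fun x : ℝ => ∫ u in (1:ℝ)..x, F u) :=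
      intervalIntegral.continuous_primitive (fun x y => hF.intervalIntegrable x y) 1
    have h1 : (fun t : ℝ => ∫ u in (1-t)..1, F u) = fun t => -∫ u in (1:ℝ)..(1-t), F u := by
      ext t; rw [intervalIntegral.integral_symm]
    rw [h1]
    exact (h0.comp (by fun_prop)).neg
  have hPm := hP.measurable
  refine Integrable.mono' ((pow_int (-a) (by linarith)).const_mul M)
    (Measurable.aestronglyMeasurable (by fun_prop)) ?_
  filter_upwards [ae_restrict_mem measurableSet_Ioc] with t ht
  rw [norm_mul, Real.norm_eq_abs, Real.norm_eq_abs, abs_of_pos (Real.rpow_pos_of_pos ht.1 _)]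
  calc _ ≤ t ^ (-a-1) * (M * t) := by
        gcongr
        · exact Real.rpow_nonneg ht.1.le _
        · exact P_bound M F hM t ht.1.le
    _ = M * (t ^ (-a-1) * t ^ (1:ℝ)) := by rw [Real.rpow_one]; ring
    _ = _ := by rw [← Real.rpow_add ht.1]; ring_nf

lemma W_int (c M : ℝ) (hc : -1 < c) (F : ℝ → ℝ) (hF : Continuous F) :
    IntervalIntegrable (fun u => (1-u) ^ c * F u) volume 0 1 := by
  have h := (intervalIntegral.intervalIntegrable_rpow' (a := 0) (b := 1) hc).comp_sub_left 1
  simp only [sub_zero, sub_self] at h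
  exact h.symm.mul_continuousOn hF.continuousOn

lemma J_eq (a M : ℝ) (ha : 0 < a) (ha1 : a < 1) (F : ℝ → ℝ) (hF : Continuous F)
    (hM : ∀ x, |F x| ≤ M) :
    a * ∫ t in (0:ℝ)..1, t ^ (-a - 1) * ∫ u in (1-t)..1, F u
      = (∫ u in (0:ℝ)..1, (1-u) ^ (-a) * F u) - ∫ u in (0:ℝ)..1, F u := by
  have hder : ∀ t : ℝ, HasDerivAt (fun t : ℝ => ∫ u in (1-t)..1, F u) (F (1-t)) t := by
    intro t
    have h0 : HasDerivAt (fun x : ℝ => ∫ u in x..1, F u) (-F (1-t)) (1-t) :=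
      intervalIntegral.integral_hasDerivAt_left (hF.intervalIntegrable _ _)
        (hF.stronglyMeasurableAtFilter _ _) hF.continuousAt
    have h1 : HasDerivAt (fun t : ℝ => 1 - t) (-1) t := by
      simpa using (hasDerivAt_id t).const_sub 1
    simpa [Function.comp_def] using h0.comp t h1
  have hW : IntervalIntegrable (fun t : ℝ => t ^ (-a) * F (1-t)) volume 0 1 :=
    (intervalIntegral.intervalIntegrable_rpow' (by linarith)).mul_continuousOn (by fun_prop)
  have hJ : IntervalIntegrable (fun t => t ^ (-a - 1) * ∫ u in (1-t)..1, F u) volume 0 1 := by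
    rw [intervalIntegrable_iff_integrableOn_Ioc_of_le zero_le_one]
    exact J_int a M ha1 F hF hM
  have hcont : ContinuousOn (fun t : ℝ => t ^ (-a) * ∫ u in (1-t)..1, F u) (Icc 0 1) := by
    intro t ht
    rcases ht.1.eq_or_lt with h0 | h0
    · subst h0
      have hz : Filter.Tendsto (fun t : ℝ => M * t ^ (1 - a)) (nhdsWithin 0 (Icc 0 1)) (nhds 0) := by
        have : ContinuousAt (fun t : ℝ => M * t ^ (1 - a)) 0 :=
          (Real.continuousAt_rpow_const 0 (1-a) (Or.inr (by linarith))).const_mul M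
        have h2 := this.tendsto
        rw [Real.zero_rpow (by linarith), mul_zero] at h2
        exact h2.mono_left nhdsWithin_le_nhds
      unfold ContinuousWithinAt
      simp only [sub_zero, intervalIntegral.integral_same, mul_zero]
      refine squeeze_zero_norm' ?_ hz
      filter_upwards [self_mem_nhdsWithin] with t ht
      rcases ht.1.eq_or_lt with h0 | h0
      · subst h0
        simp [Real.zero_rpow (show (1 - a) ≠ 0 by linarith)]
      · rw [norm_mul, Real.norm_eq_abs, Real.norm_eq_abs, abs_of_pos (Real.rpow_pos_of_pos h0 _)]
        calc _ ≤ t ^ (-a) * (M * t) := by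
              gcongr
              exact P_bound M F hM t h0.le
          _ = M * (t ^ (-a) * t ^ (1:ℝ)) := by rw [Real.rpow_one]; ring
          _ = _ := by rw [← Real.rpow_add h0]; ring_nf
    · exact ((Real.continuousAt_rpow_const t (-a) (Or.inl h0.ne')).mul
        (hder t).continuousAt).continuousWithinAt
  have hft := intervalIntegral.integral_eq_sub_of_hasDerivAt_of_le zero_le_one hcont
    (f' := fun t => (-a) * (t ^ (-a - 1) * ∫ u in (1-t)..1, F u) + t ^ (-a) * F (1-t))
    (by
      intro t ht
      have := (Real.hasDerivAt_rpow_const (x := t) (p := -a) (Or.inl ht.1.ne')).mul (hder t)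
      exact this.congr_deriv (by ring))
    ((hJ.const_mul (-a)).add hW)
  rw [intervalIntegral.integral_add (hJ.const_mul (-a)) hW,
    intervalIntegral.integral_const_mul] at hft
  have hsub : ∫ t in (0:ℝ)..1, t ^ (-a) * F (1-t) = ∫ u in (0:ℝ)..1, (1-u) ^ (-a) * F u := by
    have := intervalIntegral.integral_comp_sub_left (a := 0) (b := 1)
      (fun u => (1-u) ^ (-a) * F u) 1
    simpa using this
  rw [hsub] at hft
  simp at hft
  linarith

lemma DD_F_int (a γ K M : ℝ) (ha : 0 < a) (ha1 : a < 1) (haγ : a < γ) (F : ℝ → ℝ)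
    (hF : Continuous F) (hK : 0 ≤ K)
    (h : ∀ u v, |F v - F u| ≤ K * |v - u| ^ γ) (hF0 : ∀ x, 0 ≤ F x) (hM : ∀ x, |F x| ≤ M) :
    a * ∫ u in (0:ℝ)..1, DD a F u ≤
      (∫ u in (0:ℝ)..1, (1-u) ^ (-a) * F u) - ∫ u in (0:ℝ)..1, F u := by
  rw [← J_eq a M ha ha1 F hF hM]
  refine mul_le_mul_of_nonneg_left ?_ ha.le
  rw [intervalIntegral.integral_of_le zero_le_one, intervalIntegral.integral_of_le zero_le_one]
  unfold DD
  have h2 := NN_int2 a γ K haγ F hF hK h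
  rw [integral_integral_swap h2]
  refine setIntegral_mono_on h2.integral_prod_right (J_int a M ha1 F hF hM) measurableSet_Ioc ?_
  intro t ht
  exact inner_swap a F hF hF0 t ht

lemma core_s10 (a γ K M : ℝ) (ha : 0 < a) (ha2 : a < 1 / 2) (haγ : a < γ) (f : ℝ → ℝ)
    (hf : Continuous f) (hK : 0 ≤ K)
    (h : ∀ u v, |f v - f u| ≤ K * |v - u| ^ γ) (hM : ∀ x, |f x| ≤ M) :
    ∫ u in (0:ℝ)..1, (f u) ^ 2 ≤ ∫ u in (0:ℝ)..1, ((1-u) ^ (-a) * f u - a * DD a f u) ^ 2 := by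
  have hM0 : 0 ≤ M := (abs_nonneg _).trans (hM 0)
  set F : ℝ → ℝ := fun x => f x ^ 2 with hFdef
  have hF : Continuous F := by fun_prop
  have hFh : ∀ u v, |F v - F u| ≤ (2 * M * K) * |v - u| ^ γ := by
    intro u v
    have e : F v - F u = (f v + f u) * (f v - f u) := by simp only [hFdef]; ring
    rw [e, abs_mul]
    calc _ ≤ (2 * M) * (K * |v - u| ^ γ) := by
          gcongr
          · exact (abs_add_le _ _).trans (by linarith [hM u, hM v])
          · exact h u v
      _ = _ := by ring
  have hFK : 0 ≤ 2 * M * K := by positivity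
  have hF0 : ∀ x, 0 ≤ F x := fun x => sq_nonneg _
  have hFM : ∀ x, |F x| ≤ M ^ 2 := by
    intro x
    simp only [hFdef, abs_pow]
    exact pow_le_pow_left₀ (abs_nonneg _) (hM x) 2
  have key := DD_F_int a γ _ _ ha (by linarith) haγ F hF hFK hFh hF0 hFM
  have hDF : IntervalIntegrable (DD a F) volume 0 1 := by
    rw [intervalIntegrable_iff_integrableOn_Ioc_of_le zero_le_one]
    exact (NN_int2 a γ _ haγ F hF hFK hFh).integral_prod_left
  have hWF := W_int (-a) M (by linarith) F hF
  have hFi : IntervalIntegrable F volume 0 1 := hF.intervalIntegrable _ _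
  -- bound on DD f
  set B := ∫ t in Ioc (0:ℝ) 1, K * t ^ (γ - a - 1) with hB
  have hDb : ∀ u, |DD a f u| ≤ B := by
    intro u
    rw [← Real.norm_eq_abs]
    unfold DD
    refine norm_integral_le_of_norm_le ((pow_int (γ - a - 1) (by linarith)).const_mul K) ?_
    filter_upwards [ae_restrict_mem measurableSet_Ioc] with t ht
    exact NN_bound a γ K f hK h u t ht.1
  have hDm : AEStronglyMeasurable (DD a f) (volume.restrict (Ioc (0:ℝ) 1)) :=
    (NN_int2 a γ _ haγ f hf hK h).integral_prod_left.aestronglyMeasurable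
  have hphi : IntervalIntegrable (fun u => ((1-u) ^ (-a) * f u - a * DD a f u) ^ 2) volume 0 1 := by
    have hdom : IntervalIntegrable
        (fun u => 2 * ((1-u) ^ (-(2 * a)) * F u) + 2 * (a * B) ^ 2) volume 0 1 :=
      ((W_int (-(2*a)) M (by linarith) F hF).const_mul 2).add intervalIntegrable_const
    rw [intervalIntegrable_iff_integrableOn_Ioc_of_le zero_le_one] at hdom ⊢
    refine Integrable.mono' hdom ?_ ?_
    · have hfm := hf.measurable
      have : AEStronglyMeasurable (fun u : ℝ => (1-u) ^ (-a) * f u)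
        (volume.restrict (Ioc (0:ℝ) 1)) := Measurable.aestronglyMeasurable (by fun_prop)
      exact (this.sub (hDm.const_mul a)).pow 2
    · filter_upwards [ae_restrict_mem measurableSet_Ioc] with u hu
      rw [Real.norm_eq_abs, abs_of_nonneg (sq_nonneg _)]
      have e1 : (1-u) ^ (-(2 * a)) * F u = ((1-u) ^ (-a) * f u) ^ 2 := by
        rw [mul_pow, ← Real.rpow_mul_natCast (by linarith [hu.2])]
        simp only [hFdef]; congr 2; push_cast; ring
      have e2 : (a * DD a f u) ^ 2 ≤ (a * B) ^ 2 := by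
        rw [sq_le_sq, abs_mul, abs_of_pos ha]
        refine le_trans ?_ (le_abs_self _)
        exact mul_le_mul_of_nonneg_left (hDb u) ha.le
      rw [e1]
      nlinarith [sq_nonneg ((1-u) ^ (-a) * f u + a * DD a f u)]
  have hpt : ∀ u ∈ Icc (0:ℝ) 1, 2 * ((1-u) ^ (-a) * F u) - a * DD a F u - F u
      ≤ ((1-u) ^ (-a) * f u - a * DD a f u) ^ 2 := by
    intro u hu
    have hd : 2 * f u * DD a f u ≤ DD a F u := by
      unfold DD
      rw [← integral_const_mul]
      refine setIntegral_mono_on ((NN_int1 a γ K haγ f hf hK h u).const_mul _)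
        (NN_int1 a γ _ haγ F hF hFK hFh u) measurableSet_Ioc ?_
      intro t ht
      unfold NN
      split_ifs
      · rw [← mul_assoc]
        refine mul_le_mul_of_nonneg_right ?_ (Real.rpow_nonneg ht.1.le _)
        simp only [hFdef]
        nlinarith [sq_nonneg (f (u+t) - f u)]
      · simp
    have := mul_le_mul_of_nonneg_left hd ha.le
    have h3 := sq_nonneg ((1-u) ^ (-a) * f u - a * DD a f u - f u)
    simp only [hFdef] at this ⊢
    nlinarith
  have hmono := intervalIntegral.integral_mono_on zero_le_one
    (((hWF.const_mul 2).sub (hDF.const_mul a)).sub hFi) hphi hpt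
  rw [intervalIntegral.integral_sub ((hWF.const_mul 2).sub (hDF.const_mul a)) hFi,
    intervalIntegral.integral_sub (hWF.const_mul 2) (hDF.const_mul a),
    intervalIntegral.integral_const_mul, intervalIntegral.integral_const_mul] at hmono
  have hW1 : ∫ u in (0:ℝ)..1, F u ≤ ∫ u in (0:ℝ)..1, (1-u) ^ (-a) * F u := by
    refine intervalIntegral.integral_mono_on_of_le_Ioo zero_le_one hFi hWF ?_
    intro u hu
    have : 1 ≤ (1-u) ^ (-a) :=
      Real.one_le_rpow_of_pos_of_le_one_of_nonpos (by linarith [hu.2]) (by linarith [hu.1])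
        (by linarith)
    nlinarith [hF0 u]
  linarith

/-- For `H ∈ (1/4,1/2)` and `γ > 1/2 - H` there is `C > 0` such that
for every `γ`-Hölder `f : [0,1] → ℝ`,
`∫₀¹ ((1-u)^{H-1/2} f(u) + (H-1/2) ∫ᵤ¹ (f(r)-f(u)) (r-u)^{H-3/2} dr)² du
  ≥ C ∫₀¹ f(u)² du`. -/
theorem stmt10 (H γ : ℝ) (hH4 : 1 / 4 < H) (hH2 : H < 1 / 2) (hγ : 1 / 2 - H < γ) :
    ∃ C : ℝ, 0 < C ∧
      ∀ f : ℝ → ℝ,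
        (∃ K : ℝ, ∀ u ∈ Set.Icc (0 : ℝ) 1, ∀ v ∈ Set.Icc (0 : ℝ) 1,
            |f v - f u| ≤ K * |v - u| ^ γ) →
        C * ∫ u in (0 : ℝ)..1, (f u) ^ 2
          ≤ ∫ u in (0 : ℝ)..1,
              ((1 - u) ^ (H - 1 / 2) * f u
                + (H - 1 / 2) * ∫ r in u..1, (f r - f u) * (r - u) ^ (H - 3 / 2)) ^ 2 := by
  refine ⟨1, one_pos, ?_⟩
  rintro f ⟨K, hK⟩
  have hγ0 : 0 < γ := by linarith
  have hK0 : 0 ≤ K := by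
    have := hK 0 (by simp) 1 (by simp)
    simp at this
    exact (abs_nonneg _).trans this
  set p : ℝ → ℝ := fun x => (projIcc (0:ℝ) 1 zero_le_one x : ℝ) with hp
  have hpm : ∀ x, p x ∈ Icc (0:ℝ) 1 := fun x => (projIcc (0:ℝ) 1 zero_le_one x).2
  have hpe : ∀ x ∈ Icc (0:ℝ) 1, p x = x := fun x hx => by
    simp only [hp]; rw [projIcc_of_mem zero_le_one hx]
  set g : ℝ → ℝ := fun x => f (p x) with hg
  have hge : ∀ x ∈ Icc (0:ℝ) 1, g x = f x := fun x hx => by simp only [hg, hpe x hx]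
  have hgH : ∀ u v, |g v - g u| ≤ K * |v - u| ^ γ := by
    intro u v
    refine (hK _ (hpm u) _ (hpm v)).trans ?_
    have : |p v - p u| ≤ |v - u| := abs_projIcc_sub_projIcc zero_le_one
    gcongr
  have hgc : Continuous g := by
    rw [continuous_iff_continuousAt]
    intro u
    unfold ContinuousAt
    rw [tendsto_iff_norm_sub_tendsto_zero]
    refine squeeze_zero (fun _ => norm_nonneg _) (fun v => hgH u v) ?_
    have : Continuous (fun v : ℝ => K * |v - u| ^ γ) :=
      continuous_const.mul ((by fun_prop : Continuous fun v : ℝ => |v - u|).rpow_const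
        (fun _ => Or.inr hγ0.le))
    have h2 := this.tendsto u
    simpa [Real.zero_rpow hγ0.ne'] using h2
  have hgM : ∀ x, |g x| ≤ |f 0| + K := by
    intro x
    have h1 := hK 0 (by simp) (p x) (hpm x)
    have h2 : |p x - 0| ^ γ ≤ 1 := by
      refine Real.rpow_le_one (abs_nonneg _) ?_ hγ0.le
      rw [sub_zero, abs_of_nonneg (hpm x).1]; exact (hpm x).2
    have h3 : K * |p x - 0| ^ γ ≤ K := by nlinarith
    have h4 := abs_add_le (f 0) (f (p x) - f 0)
    rw [add_sub_cancel] at h4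
    simp only [hg]; linarith
  have := core_s10 (1/2 - H) γ K _ (by linarith) (by linarith) hγ g hgc hK0 hgH hgM
  rw [one_mul]
  have e1 : ∫ u in (0 : ℝ)..1, (f u) ^ 2 = ∫ u in (0 : ℝ)..1, (g u) ^ 2 := by
    refine intervalIntegral.integral_congr fun u hu => ?_
    rw [uIcc_of_le zero_le_one] at hu
    simp only [hge u hu]
  rw [e1]
  refine this.trans (le_of_eq ?_)
  rw [intervalIntegral.integral_of_le zero_le_one, intervalIntegral.integral_of_le zero_le_one]
  refine setIntegral_congr_fun measurableSet_Ioc fun u hu => ?_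
  have hu' : u ∈ Icc (0:ℝ) 1 := ⟨hu.1.le, hu.2⟩
  have e2 : ∫ r in u..1, (f r - f u) * (r - u) ^ (H - 3 / 2)
      = ∫ r in u..1, (g r - g u) * (r - u) ^ (-(1/2 - H) - 1) := by
    refine intervalIntegral.integral_congr fun r hr => ?_
    rw [uIcc_of_le hu.2] at hr
    have hr' : r ∈ Icc (0:ℝ) 1 := ⟨hu.1.le.trans hr.1, hr.2⟩
    simp only [hge u hu', hge r hr']
    congr 2; ring
  rw [← DD_eq _ _ _ hu] at e2
  simp only [e2, hge u hu']
  rw [show -(1/2 - H) = H - 1/2 by ring]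
  ring
end

section
/- Let H ∈ (1/4, 1/2) and γ > 1/2 − H. There exists a constant c₁ > 0 (depending only on H, γ, n) such that for every γ-Hölder continuous function f : [0,1] → ℝⁿ and all 0 ≤ s < t ≤ 1: ∫ₛᵗ | (t − u)^{H − 1/2} f(u) + (H − 1/2) ∫ᵤᵗ (f(r) − f(u)) (r − u)^{H − 3/2} dr |² du ≥ c₁ · (t − s)^{2H} · min_{u ∈ [0,1]} |f(u)|². -/
open MeasureTheory Set

section aux
variable {E : Type*} [NormedAddCommGroup E] [NormedSpace ℝ E]

lemma aux_intA (f : ℝ → E) (hf : Continuous f) (K γ a s t : ℝ)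
    (hK : ∀ u v, ‖f v - f u‖ ≤ K * |v - u| ^ γ) (hγ : 0 < γ + a) (hst : s < t) :
    Integrable (fun p : ℝ × ℝ => indicator {p : ℝ × ℝ | p.1 + p.2 ≤ t}
      (fun p => p.2 ^ (a - 1) • (f (p.1 + p.2) - f p.1)) p)
      ((volume.restrict (Ioc s t)).prod (volume.restrict (Ioc 0 (t - s)))) := by
  have hν : Integrable (fun h : ℝ => h ^ (γ + a - 1)) (volume.restrict (Ioc 0 (t - s))) := by
    have := intervalIntegral.intervalIntegrable_rpow' (a := 0) (b := t - s) (r := γ + a - 1)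
      (by linarith)
    rwa [intervalIntegrable_iff_integrableOn_Ioc_of_le (by linarith)] at this
  have hdom : Integrable (fun p : ℝ × ℝ => K * p.2 ^ (γ + a - 1))
      ((volume.restrict (Ioc s t)).prod (volume.restrict (Ioc 0 (t - s)))) :=
    (hν.comp_snd (volume.restrict (Ioc s t))).const_mul K
  refine hdom.mono' ?_ ?_
  · refine AEStronglyMeasurable.indicator ?_ ?_
    · refine AEStronglyMeasurable.smul ?_ ?_
      · exact (measurable_snd.pow_const _).aestronglyMeasurable
      · exact Continuous.aestronglyMeasurable (by fun_prop)
    · exact measurableSet_le (by fun_prop) (by fun_prop)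
  · rw [Measure.prod_restrict]
    filter_upwards [ae_restrict_mem (measurableSet_Ioc.prod measurableSet_Ioc)] with p hp
    have h2 : 0 < p.2 := hp.2.1
    refine (norm_indicator_le_norm_self _ _).trans ?_
    have h := hK p.1 (p.1 + p.2)
    rw [add_sub_cancel_left, abs_of_pos h2] at h
    rw [norm_smul, Real.norm_of_nonneg (by positivity)]
    calc _ ≤ p.2 ^ (a - 1) * (K * p.2 ^ γ) := by gcongr
      _ = _ := by
        rw [show γ + a - 1 = (a - 1) + γ by ring, Real.rpow_add h2]; ring

/-- the inner set integral -/
lemma aux_inner (f : ℝ → E) (a s t u : ℝ) (hu : u ∈ Ioc s t) :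
    ∫ h in Ioc 0 (t - s), indicator {p : ℝ × ℝ | p.1 + p.2 ≤ t}
      (fun p => p.2 ^ (a - 1) • (f (p.1 + p.2) - f p.1)) (u, h)
     = ∫ r in u..t, (r - u) ^ (a - 1) • (f r - f u) := by
  have h1 : ∀ h, indicator {p : ℝ × ℝ | p.1 + p.2 ≤ t}
      (fun p => p.2 ^ (a - 1) • (f (p.1 + p.2) - f p.1)) (u, h) =
      indicator (Iic (t - u)) (fun h => h ^ (a - 1) • (f (u + h) - f u)) h := by
    intro h
    by_cases hh : u + h ≤ t
    · rw [indicator_of_mem (by exact hh), indicator_of_mem (by simp; linarith)]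
    · rw [indicator_of_notMem (by exact hh), indicator_of_notMem (by simp; linarith)]
  simp_rw [h1]
  rw [setIntegral_indicator measurableSet_Iic, Ioc_inter_Iic,
    min_eq_right (by linarith [hu.1]), ← intervalIntegral.integral_of_le (by linarith [hu.2])]
  have := intervalIntegral.integral_comp_add_left (a := 0) (b := t - u)
    (fun r => (r - u) ^ (a - 1) • (f r - f u)) u
  simp only [add_sub_cancel_left, add_zero, add_sub_cancel] at this
  exact this
end aux

lemma aux_intB (F : ℝ → ℝ) (hF : Continuous F) (M a s t : ℝ)
    (hM : ∀ u, |F u| ≤ M) (ha : -1/2 < a) (ha0 : a < 0) (hst : s < t) :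
    Integrable (fun p : ℝ × ℝ => indicator {p : ℝ × ℝ | t < p.1 + p.2}
      (fun p => p.2 ^ (a - 1) * F p.1) p)
      ((volume.restrict (Ioc s t)).prod (volume.restrict (Ioc 0 (t - s)))) := by
  have hν : Integrable (fun h : ℝ => h ^ (a - 1/2)) (volume.restrict (Ioc 0 (t - s))) := by
    have := intervalIntegral.intervalIntegrable_rpow' (a := 0) (b := t - s) (r := a - 1/2)
      (by linarith)
    rwa [intervalIntegrable_iff_integrableOn_Ioc_of_le (by linarith)] at this
  have hμ : Integrable (fun u : ℝ => M * (t - u) ^ (-1/2 : ℝ)) (volume.restrict (Ioc s t)) := by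
    have := (intervalIntegral.intervalIntegrable_rpow' (a := 0) (b := t - s) (r := -1/2)
      (by norm_num)).comp_sub_left t
    rw [sub_zero, sub_sub_cancel] at this
    have := this.symm
    rw [intervalIntegrable_iff_integrableOn_Ioc_of_le (by linarith)] at this
    exact this.const_mul M
  refine (hμ.mul_prod hν).mono' ?_ ?_
  · refine AEStronglyMeasurable.indicator ?_ ?_
    · refine AEStronglyMeasurable.mul ?_ ?_
      · exact (measurable_snd.pow_const _).aestronglyMeasurable
      · exact Continuous.aestronglyMeasurable (by fun_prop)
    · exact measurableSet_lt (by fun_prop) (by fun_prop)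
  · have hM0 : 0 ≤ M := (abs_nonneg _).trans (hM 0)
    have hne : ∀ᵐ p : ℝ × ℝ ∂((volume.restrict (Ioc s t)).prod (volume.restrict (Ioc 0 (t - s)))),
        p.1 ≠ t := by
      have : ∀ᵐ u ∂(volume.restrict (Ioc s t)), u ≠ t := Measure.ae_ne _ _
      exact Measure.quasiMeasurePreserving_fst.ae this
    rw [Measure.prod_restrict] at hne ⊢
    filter_upwards [hne, ae_restrict_mem (measurableSet_Ioc.prod measurableSet_Ioc)] with p hne hp
    have h2 : 0 < p.2 := hp.2.1
    have h1 : 0 < t - p.1 := sub_pos.2 (lt_of_le_of_ne hp.1.2 hne)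
    by_cases hh : t < p.1 + p.2
    · rw [indicator_of_mem (by exact hh), norm_mul, Real.norm_of_nonneg (by positivity)]
      calc _ ≤ p.2 ^ (a - 1) * M := by gcongr; exact hM _
        _ = M * p.2 ^ (-1/2 : ℝ) * p.2 ^ (a - 1/2) := by
          rw [show a - 1 = (-1/2) + (a - 1/2) by ring, Real.rpow_add h2]; ring
        _ ≤ _ := by
          have : p.2 ^ (-1/2 : ℝ) ≤ (t - p.1) ^ (-1/2 : ℝ) :=
            Real.rpow_le_rpow_of_nonpos h1 (by linarith) (by norm_num)
          gcongr
    · rw [indicator_of_notMem (by exact hh), norm_zero]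
      positivity

lemma aux_Q (F : ℝ → ℝ) (hF : Continuous F) (K M γ a s t : ℝ) (hF0 : ∀ u, 0 ≤ F u)
    (hK : ∀ u v, ‖F v - F u‖ ≤ K * |v - u| ^ γ)
    (hM : ∀ u, |F u| ≤ M) (hγ : 0 < γ + a) (ha : -1/2 < a) (ha0 : a < 0) (hst : s < t) :
    ∫ u in Ioc s t, ∫ h in Ioc 0 (t - s), indicator {p : ℝ × ℝ | p.1 + p.2 ≤ t}
      (fun p => p.2 ^ (a - 1) • (F (p.1 + p.2) - F p.1)) (u, h)
     ≤ ∫ u in Ioc s t, F u * (((t - s) ^ a - (t - u) ^ a) / a) := by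
  have iA := aux_intA F hF K γ a s t hK hγ hst
  have iB := aux_intB F hF M a s t hM ha ha0 hst
  calc _ = ∫ h in Ioc 0 (t - s), ∫ u in Ioc s t, indicator {p : ℝ × ℝ | p.1 + p.2 ≤ t}
          (fun p => p.2 ^ (a - 1) • (F (p.1 + p.2) - F p.1)) (u, h) := by
        exact integral_integral_swap iA
    _ ≤ ∫ h in Ioc 0 (t - s), ∫ u in Ioc s t, indicator {p : ℝ × ℝ | t < p.1 + p.2}
          (fun p => p.2 ^ (a - 1) * F p.1) (u, h) := by
        refine setIntegral_mono_on iA.integral_prod_right iB.integral_prod_right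
          measurableSet_Ioc ?_
        intro h hh
        have e1 : ∀ u, indicator {p : ℝ × ℝ | p.1 + p.2 ≤ t}
            (fun p => p.2 ^ (a - 1) • (F (p.1 + p.2) - F p.1)) (u, h) =
            indicator (Iic (t - h)) (fun u => h ^ (a - 1) • (F (u + h) - F u)) u := by
          intro u
          by_cases hu : u + h ≤ t
          · rw [indicator_of_mem (by exact hu), indicator_of_mem (by simp; linarith)]
          · rw [indicator_of_notMem (by exact hu), indicator_of_notMem (by simp; linarith)]
        have e2 : ∀ u, indicator {p : ℝ × ℝ | t < p.1 + p.2}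
            (fun p => p.2 ^ (a - 1) * F p.1) (u, h) =
            indicator (Ioi (t - h)) (fun u => h ^ (a - 1) * F u) u := by
          intro u
          by_cases hu : t < u + h
          · rw [indicator_of_mem (by exact hu), indicator_of_mem (by simp; linarith)]
          · rw [indicator_of_notMem (by exact hu), indicator_of_notMem (by simp; linarith)]
        simp_rw [e1, e2]
        have hhs : s ≤ t - h := by linarith [hh.2]
        have hht : t - h ≤ t := by linarith [hh.1]
        rw [setIntegral_indicator measurableSet_Iic, setIntegral_indicator measurableSet_Ioi,
          Ioc_inter_Iic, Ioc_inter_Ioi, min_eq_right hht, max_eq_right hhs, integral_smul,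
          integral_const_mul, smul_eq_mul]
        have := hh.1
        refine mul_le_mul_of_nonneg_left ?_ (by positivity)
        rw [← intervalIntegral.integral_of_le hhs, ← intervalIntegral.integral_of_le hht]
        have ii : ∀ x y, IntervalIntegrable F volume x y := fun x y => hF.intervalIntegrable x y
        rw [intervalIntegral.integral_sub (Continuous.intervalIntegrable (by fun_prop) _ _)
          (ii _ _), intervalIntegral.integral_comp_add_right (fun u => F u) h, sub_add_cancel]
        have q1 := intervalIntegral.integral_add_adjacent_intervals (ii s (t-h)) (ii (t-h) t)
        have q2 := intervalIntegral.integral_add_adjacent_intervals (ii s (s+h)) (ii (s+h) t)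
        have q3 : 0 ≤ ∫ u in s..(s+h), F u :=
          intervalIntegral.integral_nonneg (by linarith) (fun u _ => hF0 u)
        linarith
    _ = ∫ u in Ioc s t, ∫ h in Ioc 0 (t - s), indicator {p : ℝ × ℝ | t < p.1 + p.2}
          (fun p => p.2 ^ (a - 1) * F p.1) (u, h) := (integral_integral_swap iB).symm
    _ = _ := by
        have hne : ∀ᵐ u ∂(volume.restrict (Ioc s t)), u ≠ t := Measure.ae_ne _ _
        refine integral_congr_ae ?_
        filter_upwards [hne, ae_restrict_mem measurableSet_Ioc] with u hne hu
        have hut : 0 < t - u := sub_pos.2 (lt_of_le_of_ne hu.2 hne)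
        have e2 : ∀ h, indicator {p : ℝ × ℝ | t < p.1 + p.2}
            (fun p => p.2 ^ (a - 1) * F p.1) (u, h) =
            indicator (Ioi (t - u)) (fun h => h ^ (a - 1) * F u) h := by
          intro h
          by_cases hh : t < u + h
          · rw [indicator_of_mem (by exact hh), indicator_of_mem (by simp; linarith)]
          · rw [indicator_of_notMem (by exact hh), indicator_of_notMem (by simp; linarith)]
        simp_rw [e2]
        rw [setIntegral_indicator measurableSet_Ioi, Ioc_inter_Ioi, max_eq_right hut.le,
          integral_mul_const, ← intervalIntegral.integral_of_le (by linarith [hu.1]),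
          integral_rpow, sub_add_cancel, mul_comm]
        right
        refine ⟨by linarith, ?_⟩
        rw [uIcc_of_le (by linarith [hu.1])]
        intro h0
        linarith [h0.1]

lemma aux_core {E : Type*} [NormedAddCommGroup E] [InnerProductSpace ℝ E] [CompleteSpace E]
    (f : ℝ → E) (hf : Continuous f) (K M γ a s t m : ℝ)
    (hK : ∀ u v, ‖f v - f u‖ ≤ K * |v - u| ^ γ) (hK0 : 0 ≤ K)
    (hM : ∀ u, ‖f u‖ ≤ M) (hγ : 0 < γ + a) (ha : -1/4 < a) (ha0 : a < 0) (hst : s < t)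
    (hm0 : 0 ≤ m) (hm : ∀ u ∈ Ioc s t, m ≤ ‖f u‖) :
    (t - s) ^ (2 * a + 1) * m ^ 2 ≤ ∫ u in s..t, ‖(t - u) ^ a • f u
                  + a • ∫ r in u..t, (r - u) ^ (a - 1) • (f r - f u)‖ ^ 2 := by
  have hM0 : 0 ≤ M := (norm_nonneg _).trans (hM 0)
  have hL : 0 < t - s := sub_pos.2 hst
  set F : ℝ → ℝ := fun u => ‖f u‖ ^ 2 with hFdef
  have hFc : Continuous F := by fun_prop
  have hFM : ∀ u, |F u| ≤ M ^ 2 := by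
    intro u
    rw [abs_of_nonneg (by positivity)]
    have := hM u
    simp only [F]; gcongr
  have hFK : ∀ u v, ‖F v - F u‖ ≤ (2 * M * K) * |v - u| ^ γ := by
    intro u v
    have h1 := hK u v
    have h2 : |‖f v‖ - ‖f u‖| ≤ ‖f v - f u‖ := abs_norm_sub_norm_le _ _
    have h3 : F v - F u = (‖f v‖ + ‖f u‖) * (‖f v‖ - ‖f u‖) := by simp only [F]; ring
    rw [h3, Real.norm_eq_abs, abs_mul, abs_of_nonneg (by positivity)]
    calc _ ≤ (M + M) * (K * |v - u| ^ γ) := by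
            gcongr
            · exact hM v
            · exact hM u
            · exact h2.trans h1
      _ = _ := by ring
  have iAf := aux_intA f hf K γ a s t hK hγ hst
  have iAF := aux_intA F hFc (2 * M * K) γ a s t hFK hγ hst
  have hQ := aux_Q F hFc (2 * M * K) (M ^ 2) γ a s t (fun u => by positivity) hFK hFM hγ
    (by linarith) ha0 hst
  set P : ℝ → E := fun u => ∫ h in Ioc 0 (t - s), indicator {p : ℝ × ℝ | p.1 + p.2 ≤ t}
      (fun p => p.2 ^ (a - 1) • (f (p.1 + p.2) - f p.1)) (u, h) with hP
  set Q : ℝ → ℝ := fun u => ∫ h in Ioc 0 (t - s), indicator {p : ℝ × ℝ | p.1 + p.2 ≤ t}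
      (fun p => p.2 ^ (a - 1) • (F (p.1 + p.2) - F p.1)) (u, h) with hQd
  have iP : Integrable P (volume.restrict (Ioc s t)) := iAf.integral_prod_left
  have iQ : Integrable Q (volume.restrict (Ioc s t)) := iAF.integral_prod_left
  have hrp : ∀ b : ℝ, -1 < b → Integrable (fun u : ℝ => (t - u) ^ b) (volume.restrict (Ioc s t)) := by
    intro b hb
    have := (intervalIntegral.intervalIntegrable_rpow' (a := 0) (b := t - s) (r := b)
      hb).comp_sub_left t
    rw [sub_zero, sub_sub_cancel] at this
    have := this.symm
    rwa [intervalIntegrable_iff_integrableOn_Ioc_of_le (by linarith)] at this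
  have iF : Integrable F (volume.restrict (Ioc s t)) := (hFc.integrableOn_Icc).mono_set Ioc_subset_Icc_self
  have iaF : Integrable (fun u => (t - u) ^ a * F u) (volume.restrict (Ioc s t)) :=
    (hrp a (by linarith)).mul_bdd (c := M ^ 2) hFc.aestronglyMeasurable
      (Filter.Eventually.of_forall hFM)
  -- bound on P
  have hPb : ∃ C, ∀ᵐ u ∂(volume.restrict (Ioc s t)), ‖P u‖ ≤ C := by
    have hν : Integrable (fun h : ℝ => K * h ^ (γ + a - 1)) (volume.restrict (Ioc 0 (t - s))) := by
      have := intervalIntegral.intervalIntegrable_rpow' (a := 0) (b := t - s) (r := γ + a - 1)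
        (by linarith)
      rw [intervalIntegrable_iff_integrableOn_Ioc_of_le (by linarith)] at this
      exact this.const_mul K
    refine ⟨∫ h in Ioc 0 (t - s), K * h ^ (γ + a - 1), Filter.Eventually.of_forall fun u => ?_⟩
    refine norm_integral_le_of_norm_le hν ?_
    filter_upwards [ae_restrict_mem measurableSet_Ioc] with h hh
    refine (norm_indicator_le_norm_self _ _).trans ?_
    have h2 : 0 < h := hh.1
    have h3 := hK u (u + h)
    rw [add_sub_cancel_left, abs_of_pos h2] at h3
    simp only
    rw [norm_smul, Real.norm_of_nonneg (by positivity)]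
    calc _ ≤ h ^ (a - 1) * (K * h ^ γ) := by gcongr
      _ = _ := by
        rw [show γ + a - 1 = (a - 1) + γ by ring, Real.rpow_add h2]; ring
  obtain ⟨C, hC⟩ := hPb
  have ig : Integrable (fun u => ‖(t - u) ^ a • f u + a • P u‖ ^ 2) (volume.restrict (Ioc s t)) := by
    have idom : Integrable (fun u => 2 * (M ^ 2 * (t - u) ^ (2 * a)) + 2 * (a ^ 2 * C ^ 2))
        (volume.restrict (Ioc s t)) :=
      (((hrp (2 * a) (by linarith)).const_mul _).const_mul _).add (integrable_const _)
    refine idom.mono' ?_ ?_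
    · refine AEStronglyMeasurable.pow (AEStronglyMeasurable.norm ?_) 2
      refine AEStronglyMeasurable.add ?_ (iP.aestronglyMeasurable.const_smul a)
      exact (hrp a (by linarith)).aestronglyMeasurable.smul hf.aestronglyMeasurable
    · filter_upwards [hC, ae_restrict_mem measurableSet_Ioc] with u hu hut
      have htu : 0 ≤ t - u := by linarith [hut.2]
      rw [Real.norm_of_nonneg (by positivity)]
      have h1 : ‖(t - u) ^ a • f u‖ ^ 2 ≤ M ^ 2 * (t - u) ^ (2 * a) := by
        rw [norm_smul, mul_pow, Real.norm_of_nonneg (by positivity), mul_comm, mul_comm 2 a,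
          Real.rpow_mul htu, Real.rpow_two]
        have := hM u
        gcongr
      have h2 : ‖a • P u‖ ^ 2 ≤ a ^ 2 * C ^ 2 := by
        rw [norm_smul, mul_pow, Real.norm_eq_abs, sq_abs]
        gcongr
      have h3 := norm_add_le ((t - u) ^ a • f u) (a • P u)
      have h4 : ‖(t - u) ^ a • f u + a • P u‖ ^ 2 ≤ (‖(t - u) ^ a • f u‖ + ‖a • P u‖) ^ 2 := by
        gcongr
      nlinarith [sq_nonneg (‖(t - u) ^ a • f u‖ - ‖a • P u‖)]
  set l : ℝ := (t - s) ^ a with hl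
  have hl0 : 0 < l := by positivity
  have key : ∀ᵐ u ∂(volume.restrict (Ioc s t)),
      2 * l * ((t - u) ^ a * F u + a / 2 * Q u) - l ^ 2 * F u
        ≤ ‖(t - u) ^ a • f u + a • P u‖ ^ 2 := by
    filter_upwards [iAf.prod_right_ae, iAF.prod_right_ae] with u i1 i2
    have h1 : inner ℝ (f u) (P u) ≤ Q u / 2 := by
      have e1 : inner ℝ (f u) (P u) = ∫ h in Ioc 0 (t - s), inner ℝ (f u)
          (indicator {p : ℝ × ℝ | p.1 + p.2 ≤ t}
      (fun p => p.2 ^ (a - 1) • (f (p.1 + p.2) - f p.1)) (u, h)) := (integral_inner i1 (f u)).symm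
      rw [e1, hQd, ← integral_div]
      refine setIntegral_mono_on (i1.const_inner (f u)) (i2.div_const 2) measurableSet_Ioc ?_
      intro h hh
      have h0 := hh.1
      by_cases hu : u + h ≤ t
      · rw [indicator_of_mem (by exact hu), indicator_of_mem (by exact hu)]
        simp only [inner_smul_right, smul_eq_mul, inner_sub_right, real_inner_self_eq_norm_sq, F]
        rw [mul_div_assoc]
        refine mul_le_mul_of_nonneg_left ?_ (by positivity)
        have := norm_sub_sq_real (f u) (f (u + h))
        nlinarith [sq_nonneg ‖f u - f (u + h)‖]
      · rw [indicator_of_notMem (by exact hu), indicator_of_notMem (by exact hu)]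
        simp
    have h2 : 0 ≤ ‖((t - u) ^ a • f u + a • P u) - l • f u‖ ^ 2 := by positivity
    rw [norm_sub_sq_real] at h2
    simp only [inner_smul_right, inner_add_left, inner_smul_left, norm_smul, real_inner_self_eq_norm_sq,
      Real.norm_of_nonneg hl0.le, mul_pow] at h2
    rw [real_inner_comm] at h2
    simp only [conj_trivial] at h2
    have h3 : l * (-a) * inner ℝ (f u) (P u) ≤ l * (-a) * (Q u / 2) :=
      mul_le_mul_of_nonneg_left h1 (mul_nonneg hl0.le (by linarith))
    simp only [F]
    nlinarith
  have main := integral_mono_ae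
    ((((iaF.add (iQ.const_mul (a / 2))).const_mul (2 * l))).sub (iF.const_mul (l ^ 2))) ig
    (by filter_upwards [key] with u hu using hu)
  have e : ∫ u in s..t, ‖(t - u) ^ a • f u
                  + a • ∫ r in u..t, (r - u) ^ (a - 1) • (f r - f u)‖ ^ 2
      = ∫ u in Ioc s t, ‖(t - u) ^ a • f u + a • P u‖ ^ 2 := by
    rw [intervalIntegral.integral_of_le hst.le]
    refine setIntegral_congr_fun measurableSet_Ioc ?_
    intro u hu
    simp only [hP]
    rw [aux_inner f a s t u hu]
  rw [e]
  refine le_trans ?_ main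
  have e2 : ∫ u in Ioc s t, F u * ((l - (t - u) ^ a) / a)
      = (l * (∫ u in Ioc s t, F u) - ∫ u in Ioc s t, (t - u) ^ a * F u) / a := by
    rw [← integral_const_mul, ← integral_sub (iF.const_mul l) iaF, ← integral_div]
    congr 1; ext u; ring
  rw [e2] at hQ
  have e3 : ∫ u in Ioc s t, (2 * l * ((t - u) ^ a * F u + a / 2 * Q u) - l ^ 2 * F u)
     = 2 * l * ((∫ u in Ioc s t, (t - u) ^ a * F u) + a / 2 * ∫ u in Ioc s t, Q u)
       - l ^ 2 * ∫ u in Ioc s t, F u := by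
    have i3 : Integrable (fun u => (t - u) ^ a * F u + a / 2 * Q u) (volume.restrict (Ioc s t)) :=
      iaF.add (iQ.const_mul (a / 2))
    rw [integral_sub (i3.const_mul (2 * l)) (iF.const_mul (l ^ 2)),
      integral_const_mul, integral_const_mul, integral_add iaF (iQ.const_mul (a / 2)),
      integral_const_mul]
  refine le_trans ?_ (le_of_eq e3.symm)
  set A := ∫ u in Ioc s t, (t - u) ^ a * F u
  set B := ∫ u in Ioc s t, F u with hB
  have hQ2 : l * B - A ≤ a * ∫ u in Ioc s t, Q u := by
    have := mul_le_mul_of_nonpos_left hQ ha0.le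
    rwa [mul_div_cancel₀ _ ha0.ne] at this
  have hAB : l * B ≤ A := by
    rw [hB, ← integral_const_mul]
    refine integral_mono_ae (iF.const_mul l) iaF ?_
    have hne : ∀ᵐ u ∂(volume.restrict (Ioc s t)), u ≠ t := Measure.ae_ne _ _
    filter_upwards [hne, ae_restrict_mem measurableSet_Ioc] with u hne hu
    have hut : 0 < t - u := sub_pos.2 (lt_of_le_of_ne hu.2 hne)
    have : l ≤ (t - u) ^ a := Real.rpow_le_rpow_of_nonpos hut (by linarith [hu.1]) ha0.le
    have : 0 ≤ F u := by positivity
    gcongr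
  have hBm : (t - s) * m ^ 2 ≤ B := by
    have : ∫ u in Ioc s t, m ^ 2 ≤ B := by
      refine setIntegral_mono_on (integrable_const _) iF measurableSet_Ioc ?_
      intro u hu
      have := hm u hu
      simp only [F]; gcongr
    simpa [hst.le] using this
  have e4 : (t - s) ^ (2 * a + 1) = l ^ 2 * (t - s) := by
    rw [Real.rpow_add_one hL.ne', mul_comm 2 a, Real.rpow_mul hL.le, Real.rpow_two]
  rw [e4]
  have h5 : l ^ 2 * ((t - s) * m ^ 2) ≤ l ^ 2 * B := by gcongr
  have h6 : l * (l * B - A) ≤ l * (a * ∫ u in Ioc s t, Q u) := by gcongr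
  have h7 : l * (l * B) ≤ l * A := by gcongr
  nlinarith

theorem stmt11 (n : ℕ) (H γ : ℝ) (hH4 : 1 / 4 < H) (hH2 : H < 1 / 2)
    (hγ : 1 / 2 - H < γ) :
    ∃ c₁ : ℝ, 0 < c₁ ∧
      ∀ f : ℝ → EuclideanSpace ℝ (Fin n),
        (∃ K : ℝ, ∀ u ∈ Set.Icc (0 : ℝ) 1, ∀ v ∈ Set.Icc (0 : ℝ) 1,
            ‖f v - f u‖ ≤ K * |v - u| ^ γ) →
        ∀ s t : ℝ, 0 ≤ s → s < t → t ≤ 1 →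
          c₁ * (t - s) ^ (2 * H) * minNorm01 f ^ 2
            ≤ ∫ u in s..t,
                ‖(t - u) ^ (H - 1 / 2) • f u
                  + (H - 1 / 2) • ∫ r in u..t, (r - u) ^ (H - 3 / 2) • (f r - f u)‖ ^ 2 := by
  refine ⟨1, one_pos, ?_⟩
  rintro f ⟨K₀, hK₀⟩ s t hs hst ht
  have hγ0 : 0 < γ := by linarith
  set K := max K₀ 0 with hKd
  have hK0 : 0 ≤ K := le_max_right _ _
  have hK : ∀ u ∈ Set.Icc (0 : ℝ) 1, ∀ v ∈ Set.Icc (0 : ℝ) 1,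
            ‖f v - f u‖ ≤ K * |v - u| ^ γ := fun u hu v hv =>
    (hK₀ u hu v hv).trans (mul_le_mul_of_nonneg_right (le_max_left _ _) (by positivity))
  set c : ℝ → ℝ := fun x => max 0 (min 1 x) with hc
  have hcm : ∀ x, c x ∈ Set.Icc (0:ℝ) 1 := fun x => ⟨le_max_left _ _, by simp [hc]⟩
  have hcid : ∀ x ∈ Set.Icc (0:ℝ) 1, c x = x := fun x hx => by
    simp only [hc]; rw [min_eq_right hx.2, max_eq_right hx.1]
  have hcl : ∀ u v, |c v - c u| ≤ |v - u| := fun u v => by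
    simp only [hc]
    refine (abs_max_sub_max_le_max _ _ _ _).trans ?_
    rw [sub_self, abs_zero]
    refine max_le (abs_nonneg _) ((abs_min_sub_min_le_max _ _ _ _).trans ?_)
    simp
  set g : ℝ → EuclideanSpace ℝ (Fin n) := fun x => f (c x) with hg
  have hgK : ∀ u v, ‖g v - g u‖ ≤ K * |v - u| ^ γ := fun u v =>
    (hK _ (hcm u) _ (hcm v)).trans (by
      have := hcl u v
      gcongr)
  have hgc : Continuous g := by
    rw [continuous_iff_continuousAt]
    intro x
    rw [ContinuousAt, tendsto_iff_norm_sub_tendsto_zero]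
    refine squeeze_zero (fun _ => norm_nonneg _) (fun y => hgK x y) ?_
    have : Continuous (fun y : ℝ => K * |y - x| ^ γ) := by
      refine continuous_const.mul (Continuous.rpow_const (by fun_prop) (fun _ => Or.inr hγ0.le))
    have := this.tendsto x
    simpa [Real.zero_rpow hγ0.ne'] using this
  have hgM : ∀ u, ‖g u‖ ≤ ‖f 0‖ + K := by
    intro u
    have h0 : (0:ℝ) ∈ Set.Icc (0:ℝ) 1 := by simp
    have h1 := hK 0 h0 _ (hcm u)
    have h2 : |c u - 0| ^ γ ≤ 1 := by
      refine Real.rpow_le_one (abs_nonneg _) ?_ hγ0.le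
      rw [sub_zero, abs_of_nonneg (hcm u).1]; exact (hcm u).2
    have h3 : ‖g u‖ ≤ ‖f 0‖ + ‖f (c u) - f 0‖ := by
      have := norm_add_le (f 0) (f (c u) - f 0)
      rwa [add_sub_cancel] at this
    nlinarith
  have hgf : ∀ u, 0 ≤ u → u ≤ 1 → g u = f u := fun u h0 h1 => by
    simp only [hg]; rw [hcid u ⟨h0, h1⟩]
  have hmin : ∀ u ∈ Ioc s t, minNorm01 f ≤ ‖g u‖ := by
    intro u hu
    refine csInf_le ⟨0, ?_⟩ ⟨c u, hcm u, rfl⟩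
    rintro _ ⟨x, _, rfl⟩
    exact norm_nonneg _
  have hmin0 : 0 ≤ minNorm01 f := by
    refine Real.sInf_nonneg ?_
    rintro _ ⟨x, _, rfl⟩
    exact norm_nonneg _
  have := aux_core g hgc K (‖f 0‖ + K) γ (H - 1/2) s t (minNorm01 f) hgK hK0 hgM (by linarith)
    (by linarith) (by linarith) hst hmin0 hmin
  rw [show 2 * (H - 1/2) + 1 = 2 * H by ring] at this
  rw [one_mul]
  refine this.trans (le_of_eq ?_)
  refine intervalIntegral.integral_congr ?_
  intro u hu
  rw [uIcc_of_le hst.le] at hu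
  have hu0 : 0 ≤ u := hs.trans hu.1
  simp only
  rw [hgf u hu0 (hu.2.trans ht)]
  have : ∫ r in u..t, (r - u) ^ (H - 1/2 - 1) • (g r - f u)
      = ∫ r in u..t, (r - u) ^ (H - 3/2) • (f r - f u) := by
    refine intervalIntegral.integral_congr ?_
    intro r hr
    rw [uIcc_of_le hu.2] at hr
    simp only
    rw [hgf r (hu0.trans hr.1) (hr.2.trans ht), show H - 1/2 - 1 = H - 3/2 by ring]
  rw [this]
end
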